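/- arXiv:1605.03113 — 6 statements merged into one kernel-verified Lean document; each statement's English description precedes it below -/
import Mathlib

section
/- Let k be an algebraically closed field of characteristic 0 and ζ ∈ k a primitive 5th root of unity. Let q be the 2×2 matrix with q_{11} = ζ², q_{12} = ζ, q_{21} = ζ², q_{22} = ζ (a braiding matrix of Cartan type B₂). Then for every λ₁, λ₂ ∈ k, the quotient of the free algebra k⟨y_1,y_2⟩ by the two-sided ideal generated by y_{112} − λ₁ and y_{2221} − λ₂ is a nontrivial algebra. -/
/-- The `q`-bilinear form `q(α,β) = ∏ i j, (q i j) ^ (α i * β j)` on `ℕⁿ`-degrees. -/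
noncomputable def qForm {k : Type*} [Field k] {n : ℕ} (q : Fin n → Fin n → k)
    (α β : Fin n → ℕ) : k :=
  ∏ i : Fin n, ∏ j : Fin n, q i j ^ (α i * β j)

/-- The braided commutator on pairs (homogeneous element, its `ℕⁿ`-degree):
`[u,v]_c = u v − q(deg u, deg v) v u`. -/
noncomputable def bc {k : Type*} [Field k] {n : ℕ} (q : Fin n → Fin n → k)
    (u v : FreeAlgebra k (Fin n) × (Fin n → ℕ)) :
    FreeAlgebra k (Fin n) × (Fin n → ℕ) :=
  (u.1 * v.1 - qForm q u.2 v.2 • (v.1 * u.1), fun i => u.2 i + v.2 i)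

/-- The generator `y i` of the free algebra, together with its degree `e_i`. -/
noncomputable def ygen (k : Type*) [Field k] {n : ℕ} (i : Fin n) :
    FreeAlgebra k (Fin n) × (Fin n → ℕ) :=
  (FreeAlgebra.ι k i, fun j => if j = i then 1 else 0)

set_option maxHeartbeats 4000000

theorem not_mem_aux {k : Type*} [Field k] (ζ : k) (hζ : ζ ^ 5 = 1) (lam₁ lam₂ : k)
    (q : Fin 2 → Fin 2 → k) (hq : q = ![![ζ ^ 2, ζ], ![ζ ^ 2, ζ]])
    {A : Type*} [Ring A] [Algebra k A] [Nontrivial A] (X Y : A)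
    (h1 : X * (X * Y - ζ • (Y * X)) - ζ ^ 3 • ((X * Y - ζ • (Y * X)) * X) = algebraMap k A lam₁)
    (h2 : Y * (Y * (Y * X - ζ ^ 2 • (X * Y)) - ζ ^ 3 • ((Y * X - ζ ^ 2 • (X * Y)) * Y))
      - ζ ^ 4 • ((Y * (Y * X - ζ ^ 2 • (X * Y)) - ζ ^ 3 • ((Y * X - ζ ^ 2 • (X * Y)) * Y)) * Y)
      = algebraMap k A lam₂) :
    (1 : FreeAlgebra k (Fin 2)) ∉ TwoSidedIdeal.span
      ({(bc q (ygen k 0) (bc q (ygen k 0) (ygen k 1))).1 - algebraMap k (FreeAlgebra k (Fin 2)) lam₁,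
        (bc q (ygen k 1) (bc q (ygen k 1) (bc q (ygen k 1) (ygen k 0)))).1 - algebraMap k (FreeAlgebra k (Fin 2)) lam₂} : Set (FreeAlgebra k (Fin 2))) := by
  intro hmem
  let f : FreeAlgebra k (Fin 2) →ₐ[k] A := FreeAlgebra.lift k ![X, Y]
  have f0 : f (FreeAlgebra.ι k 0) = X := by simp [f]
  have f1 : f (FreeAlgebra.ι k 1) = Y := by simp [f]
  have hf1 : (1 : FreeAlgebra k (Fin 2)) ∈ TwoSidedIdeal.ker f := by
    refine TwoSidedIdeal.span_le.2 ?_ hmem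
    intro z hz
    rw [SetLike.mem_coe, TwoSidedIdeal.mem_ker]
    rcases hz with rfl | rfl
    · rw [map_sub, AlgHom.commutes, ← h1]
      have e : ζ ^ 2 * ζ = ζ ^ 3 := by ring
      simp [bc, ygen, qForm, Fin.prod_univ_two, hq, f0, f1, e]
    · rw [map_sub, AlgHom.commutes, ← h2]
      have e : ζ ^ 2 * ζ = ζ ^ 3 := by ring
      have e' : ζ ^ 2 * ζ ^ 2 = ζ ^ 4 := by ring
      simp [bc, ygen, qForm, Fin.prod_univ_two, hq, f0, f1, e, e']
  rw [TwoSidedIdeal.mem_ker, map_one] at hf1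
  exact one_ne_zero hf1

theorem statement_2 {k : Type*} [Field k] [IsAlgClosed k] [CharZero k]
    (ζ : k) (hζ : IsPrimitiveRoot ζ 5)
    (lam₁ lam₂ : k)
    (q : Fin 2 → Fin 2 → k) (hq : q = ![![ζ ^ 2, ζ], ![ζ ^ 2, ζ]]) :
    (1 : FreeAlgebra k (Fin 2)) ∉ TwoSidedIdeal.span
      ({(bc q (ygen k 0) (bc q (ygen k 0) (ygen k 1))).1 - algebraMap k (FreeAlgebra k (Fin 2)) lam₁,
        (bc q (ygen k 1) (bc q (ygen k 1) (bc q (ygen k 1) (ygen k 0)))).1 - algebraMap k (FreeAlgebra k (Fin 2)) lam₂} : Set (FreeAlgebra k (Fin 2))) := by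
  subst hq
  have h5 : ζ ^ 5 = 1 := hζ.pow_eq_one
  have hs : 1 + ζ + ζ ^ 2 + ζ ^ 3 + ζ ^ 4 = 0 := by
    have := hζ.geom_sum_eq_zero (by norm_num)
    simpa [Finset.sum_range_succ] using this
  have h4 : ζ ^ 4 = -1 - ζ - ζ ^ 2 - ζ ^ 3 := by linear_combination hs
  by_cases hl1 : lam₁ = 0
  · -- `Y` is a cyclic permutation, `X` has two nonzero entries
    subst hl1
    refine not_mem_aux ζ h5 0 lam₂ _ rfl (A := Matrix (Fin 5) (Fin 5) k)
      !![0, 0, 0, 0, 0; lam₂, 0, 0, 0, 0; 0, 0, 0, 0, 0; 0, 0, -ζ * lam₂, 0, 0; 0, 0, 0, 0, 0]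
      !![0, 0, 1, 0, 0; 0, 0, 0, 1, 0; 0, 0, 0, 0, 1; 1, 0, 0, 0, 0; 0, 1, 0, 0, 0] ?_ ?_
    · ext i j
      fin_cases i <;> fin_cases j <;>
        simp [Matrix.mul_apply, Fin.sum_univ_five, Matrix.algebraMap_matrix_apply]
    · ext i j
      fin_cases i <;> fin_cases j <;>
        simp [Matrix.mul_apply, Fin.sum_univ_five, Matrix.algebraMap_matrix_apply] <;>
        grind
  by_cases hl2 : lam₂ = 0
  · subst hl2
    refine not_mem_aux ζ h5 lam₁ 0 _ rfl (A := Matrix (Fin 5) (Fin 5) k)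
      !![0, 0, 0, 0, 1; 1, 0, 0, 0, 0; 0, 1, 0, 0, 0; 0, 0, 1, 0, 0; 0, 0, 0, 1, 0]
      !![0, 0, ζ * lam₁, 0, 0; 0, 0, 0, (1 + ζ + ζ ^ 3) * lam₁, 0; 0, 0, 0, 0, lam₁;
        0, 0, 0, 0, 0; 0, 0, 0, 0, 0] ?_ ?_
    · ext i j
      fin_cases i <;> fin_cases j <;>
        simp [Matrix.mul_apply, Fin.sum_univ_five, Matrix.algebraMap_matrix_apply] <;>
        grind
    · ext i j
      fin_cases i <;> fin_cases j <;>
        simp [Matrix.mul_apply, Fin.sum_univ_five, Matrix.algebraMap_matrix_apply]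
  -- both nonzero: a one-dimensional representation
  have hne : ∀ m : ℕ, 0 < m → m < 5 → (1 - ζ ^ m) ≠ 0 := by
    intro m h0 hm h
    exact hζ.pow_ne_one_of_pos_of_lt h0.ne' hm (sub_eq_zero.1 h).symm
  have n1 : 1 - ζ ≠ 0 := by simpa using hne 1 (by norm_num) (by norm_num)
  have n2 := hne 2 (by norm_num) (by norm_num)
  have n3 := hne 3 (by norm_num) (by norm_num)
  have n4 := hne 4 (by norm_num) (by norm_num)
  obtain ⟨c1, hc1⟩ : ∃ c, c = lam₁ / ((1 - ζ) * (1 - ζ ^ 3)) := ⟨_, rfl⟩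
  obtain ⟨c2, hc2⟩ : ∃ c, c = lam₂ / ((1 - ζ ^ 2) * (1 - ζ ^ 3) * (1 - ζ ^ 4)) := ⟨_, rfl⟩
  have hc1' : c1 ≠ 0 := by rw [hc1]; exact div_ne_zero hl1 (mul_ne_zero n1 n3)
  have hc2' : c2 ≠ 0 := by
    rw [hc2]; exact div_ne_zero hl2 (mul_ne_zero (mul_ne_zero n2 n3) n4)
  have hL1 : c1 * ((1 - ζ) * (1 - ζ ^ 3)) = lam₁ := by
    rw [hc1]; exact div_mul_cancel₀ _ (mul_ne_zero n1 n3)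
  have hL2 : c2 * ((1 - ζ ^ 2) * (1 - ζ ^ 3) * (1 - ζ ^ 4)) = lam₂ := by
    rw [hc2]; exact div_mul_cancel₀ _ (mul_ne_zero (mul_ne_zero n2 n3) n4)
  obtain ⟨b, hb⟩ := IsAlgClosed.exists_pow_nat_eq (c2 ^ 2 / c1) (n := 5) (by norm_num)
  have hb0 : b ≠ 0 := by
    rintro rfl
    have : c2 ^ 2 / c1 ≠ 0 := div_ne_zero (pow_ne_zero _ hc2') hc1'
    apply this
    rw [← hb]; norm_num
  have hb' : b ^ 5 * c1 = c2 ^ 2 := by rw [hb]; exact div_mul_cancel₀ _ hc1'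
  have ha2 : (c2 / b ^ 3) * b ^ 3 = c2 := div_mul_cancel₀ _ (pow_ne_zero _ hb0)
  have ha1 : (c2 / b ^ 3) ^ 2 * b = c1 := by
    field_simp
    linear_combination -hb'
  refine not_mem_aux ζ h5 lam₁ lam₂ _ rfl (A := k) (c2 / b ^ 3) b ?_ ?_
  · simp only [smul_eq_mul, Algebra.algebraMap_self, RingHom.id_apply]
    generalize c2 / b ^ 3 = a at *
    rw [← hL1, ← ha1]; ring
  · simp only [smul_eq_mul, Algebra.algebraMap_self, RingHom.id_apply]
    generalize c2 / b ^ 3 = a at *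
    rw [← hL2, ← ha2]; ring
end

section
/- Let k be an algebraically closed field of characteristic 0 and ζ ∈ k a primitive 7th root of unity. Let q be the 2×2 matrix with q_{11} = ζ³, q_{12} = ζ, q_{21} = ζ³, q_{22} = ζ (a braiding matrix of Cartan type G₂). Then for every λ₁, λ₂ ∈ k, the quotient of the free algebra k⟨y_1,y_2⟩ by the two-sided ideal generated by y_{112} − λ₁ and y_{22221} − λ₂ is a nontrivial algebra. -/
/-- The matrix `(i,j) ↦ ζ^(w i) u(i-j)` on `Fin 7`, an element of the quantum torus at `ζ`. -/
def qt {k : Type*} [Field k] (ζ : k) (w : ℕ) (u : Fin 7 → k) : Matrix (Fin 7) (Fin 7) k :=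
  Matrix.of fun i j => ζ ^ (w * i.val) * u (i - j)

/-- The generic `c`-commutator. -/
def cc {k R : Type*} [Field k] [Ring R] [Algebra k R] (c : k) (x y : R) : R :=
  x * y - c • (y * x)

theorem qt_mul {k : Type*} [Field k] {ζ : k} (h7 : ζ ^ 7 = 1) (w w' : ℕ) (u v : Fin 7 → k) :
    qt ζ w u * qt ζ w' v =
      qt ζ (w + w') (fun e => ∑ d : Fin 7, u d * v (e - d) * ζ ^ (w' * (7 - d.val))) := by
  ext i j
  simp only [qt, Matrix.mul_apply, Matrix.of_apply, Finset.mul_sum]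
  rw [← Equiv.sum_comp (Equiv.subLeft i)]
  refine Finset.sum_congr rfl fun d _ => ?_
  have hm : (i - d).val % 7 = (i.val + (7 - d.val)) % 7 := by
    revert i d; decide
  have hp : ∀ m n : ℕ, m % 7 = n % 7 → ζ ^ m = ζ ^ n := fun m n h => by
    rw [pow_eq_pow_mod m h7, pow_eq_pow_mod n h7, h]
  have h1 : ζ ^ (w' * (i - d).val) = ζ ^ (w' * (i.val + (7 - d.val))) :=
    hp _ _ (Nat.ModEq.mul_left w' hm)
  have h2 : i - (i - d) = d := by abel
  have h3 : i - d - j = i - j - d := by abel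
  simp only [Equiv.subLeft_apply, h1, h2, h3]
  ring

theorem qt_cc {k : Type*} [Field k] {ζ : k} (h7 : ζ ^ 7 = 1) (w w' : ℕ) (u v t : Fin 7 → k)
    (c : k)
    (h : ∀ e, (∑ d : Fin 7, u d * v (e - d) * ζ ^ (w' * (7 - d.val)))
      - c * (∑ d : Fin 7, v d * u (e - d) * ζ ^ (w * (7 - d.val))) = t e) :
    cc c (qt ζ w u) (qt ζ w' v) = qt ζ (w + w') t := by
  rw [cc, qt_mul h7, qt_mul h7]
  ext i j
  simp only [qt, Matrix.sub_apply, Matrix.smul_apply, Matrix.of_apply, ← h, smul_eq_mul,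
    Nat.add_comm w' w]
  ring

theorem qt_zero {k : Type*} [Field k] {ζ : k} (w : ℕ) :
    qt ζ w ![0, 0, 0, 0, 0, 0, 0] = 0 := by
  have : (![0, 0, 0, 0, 0, 0, 0] : Fin 7 → k) = 0 := by
    ext i; fin_cases i <;> rfl
  ext i j
  simp [qt, this]

theorem qt_scalar {k : Type*} [Field k] {ζ : k} (h7 : ζ ^ 7 = 1) (c : k) :
    qt ζ 7 ![c, 0, 0, 0, 0, 0, 0] = c • (1 : Matrix (Fin 7) (Fin 7) k) := by
  ext i j
  simp only [qt, pow_mul, h7, one_pow, one_mul, Matrix.of_apply, Matrix.smul_apply,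
    Matrix.one_apply]
  fin_cases i <;> fin_cases j <;> simp

theorem cc_smul_left {k R : Type*} [Field k] [Ring R] [Algebra k R] (c s : k) (x y : R) :
    cc c (s • x) y = s • cc c x y := by
  simp only [cc, smul_mul_assoc, mul_smul_comm, smul_sub, smul_comm c s]

theorem cc_smul_right {k R : Type*} [Field k] [Ring R] [Algebra k R] (c s : k) (x y : R) :
    cc c x (s • y) = s • cc c x y := by
  simp only [cc, smul_mul_assoc, mul_smul_comm, smul_sub, smul_comm c s]

/-- A pair of elements of a nontrivial algebra satisfying the relations gives nontriviality. -/
theorem nontriv_of_rep {k : Type*} [Field k] (ζ lam₁ lam₂ : k)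
    (q : Fin 2 → Fin 2 → k) (hq : q = ![![ζ ^ 3, ζ], ![ζ ^ 3, ζ]])
    {R : Type*} [Ring R] [Algebra k R] [Nontrivial R] (A B : R)
    (h1 : cc (ζ ^ 4) A (cc ζ A B) = lam₁ • 1)
    (h2 : cc (ζ ^ 6) B (cc (ζ ^ 5) B (cc (ζ ^ 4) B (cc (ζ ^ 3) B A))) = lam₂ • 1) :
    (1 : FreeAlgebra k (Fin 2)) ∉ TwoSidedIdeal.span
      ({(bc q (ygen k 0) (bc q (ygen k 0) (ygen k 1))).1 - algebraMap k (FreeAlgebra k (Fin 2)) lam₁,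
        (bc q (ygen k 1) (bc q (ygen k 1) (bc q (ygen k 1) (bc q (ygen k 1) (ygen k 0))))).1 - algebraMap k (FreeAlgebra k (Fin 2)) lam₂} : Set (FreeAlgebra k (Fin 2))) := by
  intro hmem
  let f : FreeAlgebra k (Fin 2) →ₐ[k] R := FreeAlgebra.lift k ![A, B]
  have f0 : f (FreeAlgebra.ι k 0) = A := by simp [f]
  have f1 : f (FreeAlgebra.ι k 1) = B := by simp [f]
  have hle : TwoSidedIdeal.span
      ({(bc q (ygen k 0) (bc q (ygen k 0) (ygen k 1))).1 - algebraMap k (FreeAlgebra k (Fin 2)) lam₁,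
        (bc q (ygen k 1) (bc q (ygen k 1) (bc q (ygen k 1) (bc q (ygen k 1) (ygen k 0))))).1 - algebraMap k (FreeAlgebra k (Fin 2)) lam₂} : Set (FreeAlgebra k (Fin 2))) ≤ TwoSidedIdeal.ker f := by
    rw [TwoSidedIdeal.span_le]
    intro x hx
    rw [SetLike.mem_coe, TwoSidedIdeal.mem_ker]
    have e4 : ζ ^ 3 * ζ = ζ ^ 4 := by ring
    have e4' : ζ * ζ ^ 3 = ζ ^ 4 := by ring
    have e5 : ζ ^ 3 * ζ ^ 2 = ζ ^ 5 := by ring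
    have e6 : ζ ^ 3 * ζ ^ 3 = ζ ^ 6 := by ring
    rcases hx with rfl | rfl
    · rw [map_sub, AlgHom.commutes, Algebra.algebraMap_eq_smul_one, ← h1, sub_eq_zero]
      simp [bc, ygen, qForm, hq, f0, f1, cc, Fin.prod_univ_two, e4, e4', e5, e6]
    · rw [map_sub, AlgHom.commutes, Algebra.algebraMap_eq_smul_one, ← h2, sub_eq_zero]
      simp [bc, ygen, qForm, hq, f0, f1, cc, Fin.prod_univ_two, e4, e4', e5, e6]
  have := hle hmem
  rw [TwoSidedIdeal.mem_ker, map_one] at this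
  exact one_ne_zero this

theorem root_facts {k : Type*} [Field k] {ζ : k} (hζ : IsPrimitiveRoot ζ 7) :
    1 + ζ + ζ ^ 2 + ζ ^ 3 + ζ ^ 4 + ζ ^ 5 + ζ ^ 6 = 0 := by
  have := hζ.geom_sum_eq_zero (by norm_num)
  simpa [Finset.sum_range_succ] using this

theorem rep_one {k : Type*} [Field k] {ζ : k} (h7 : ζ ^ 7 = 1)
    (hs : 1 + ζ + ζ ^ 2 + ζ ^ 3 + ζ ^ 4 + ζ ^ 5 + ζ ^ 6 = 0) :
    ∃ A B : Matrix (Fin 7) (Fin 7) k,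
      cc (ζ ^ 4) A (cc ζ A B) = 0 ∧
      cc (ζ ^ 6) B (cc (ζ ^ 5) B (cc (ζ ^ 4) B (cc (ζ ^ 3) B A))) = (3 + 2*ζ + 4*ζ^2 + 2*ζ^3 + 3*ζ^4) • (1 : Matrix (Fin 7) (Fin 7) k) := by
  refine ⟨qt ζ 3 ![1, 0, 0, 1, -ζ^2 - ζ^3 - ζ^4 - ζ^5, 1 - ζ^3 - ζ^4, -ζ^2 - ζ^3 - ζ^4 - ζ^5],
    qt ζ 1 ![1, 0, 0, 0, 0, 0, 0], ?_, ?_⟩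
  · rw [qt_cc h7 3 1 _ _
      ![1 - ζ, 0, 0, -ζ + ζ^4, -1 - ζ + ζ^3 + ζ^4, 1 + 2*ζ^2 + ζ^3 + 2*ζ^4 + ζ^5, 0] _ (by
        intro e
        fin_cases e <;> simp [Fin.sum_univ_seven] <;> grind)]
    rw [qt_cc h7 3 4 _ _
      ![0, 0, 0, 0, 0, 0, 0] _ (by
        intro e
        fin_cases e <;> simp [Fin.sum_univ_seven] <;> grind)]
    exact qt_zero _
  · rw [qt_cc h7 1 3 _ _
      ![1 - ζ^3, 0, 0, 0, ζ - ζ^5, 1 + ζ + ζ^2 - ζ^3 - ζ^4 - ζ^5, -ζ^2 - 2*ζ^3 - 2*ζ^4 - 2*ζ^5] _ (by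
        intro e
        fin_cases e <;> simp [Fin.sum_univ_seven] <;> grind)]
    rw [qt_cc h7 1 4 _ _
      ![2 - ζ^3 - ζ^4, 0, 0, 0, 0, 1 + ζ + 3*ζ^2 + ζ^3 + ζ^4, 1 + 2*ζ + ζ^2 - 2*ζ^4 - 2*ζ^5] _ (by
        intro e
        fin_cases e <;> simp [Fin.sum_univ_seven] <;> grind)]
    rw [qt_cc h7 1 5 _ _
      ![2 + ζ + ζ^2 - ζ^3 - ζ^4 - 2*ζ^5, 0, 0, 0, 0, 0, 2*ζ + 2*ζ^2 + 3*ζ^3 + ζ^4 - ζ^5] _ (by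
        intro e
        fin_cases e <;> simp [Fin.sum_univ_seven] <;> grind)]
    rw [qt_cc h7 1 6 _ _
      ![3 + 2*ζ + 4*ζ^2 + 2*ζ^3 + 3*ζ^4, 0, 0, 0, 0, 0, 0] _ (by
        intro e
        fin_cases e <;> simp [Fin.sum_univ_seven] <;> grind)]
    exact qt_scalar h7 _

theorem rep_two {k : Type*} [Field k] {ζ : k} (h7 : ζ ^ 7 = 1)
    (hs : 1 + ζ + ζ ^ 2 + ζ ^ 3 + ζ ^ 4 + ζ ^ 5 + ζ ^ 6 = 0) :
    ∃ A B : Matrix (Fin 7) (Fin 7) k,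
      cc (ζ ^ 4) A (cc ζ A B) = (1 - ζ - ζ^4 + ζ^5) • (1 : Matrix (Fin 7) (Fin 7) k) ∧
      cc (ζ ^ 6) B (cc (ζ ^ 5) B (cc (ζ ^ 4) B (cc (ζ ^ 3) B A))) = 0 := by
  refine ⟨qt ζ 1 ![1, 0, 0, 0, 0, 0, 0],
    qt ζ 5 ![1, 1, 0, 0, -ζ^2 - ζ^5, 0, 0], ?_, ?_⟩
  · rw [qt_cc h7 1 5 _ _
      ![1 - ζ, 0, 0, 0, -1 - ζ - ζ^2 - ζ^3 - ζ^4 - 2*ζ^5, 0, 0] _ (by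
        intro e
        fin_cases e <;> simp [Fin.sum_univ_seven] <;> grind)]
    rw [qt_cc h7 1 6 _ _
      ![1 - ζ - ζ^4 + ζ^5, 0, 0, 0, 0, 0, 0] _ (by
        intro e
        fin_cases e <;> simp [Fin.sum_univ_seven] <;> grind)]
    exact qt_scalar h7 _
  · rw [qt_cc h7 5 1 _ _
      ![1 - ζ^3, -1 - ζ - ζ^2 - 2*ζ^3 - ζ^4 - ζ^5, 0, 0, 0, 0, 0] _ (by
        intro e
        fin_cases e <;> simp [Fin.sum_univ_seven] <;> grind)]
    rw [qt_cc h7 5 6 _ _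
      ![2 - ζ^3 - ζ^4, -2*ζ^3 - 3*ζ^4 - 2*ζ^5, 1 + ζ^2 - ζ^4 - ζ^5, 0, 0, -ζ + ζ^2 + ζ^3 - ζ^4, 0] _ (by
        intro e
        fin_cases e <;> simp [Fin.sum_univ_seven] <;> grind)]
    rw [qt_cc h7 5 11 _ _
      ![2 + ζ + ζ^2 - ζ^3 - ζ^4 - 2*ζ^5, 2*ζ + 2*ζ^2 + 3*ζ^3 + ζ^4 - ζ^5, -1 + ζ + ζ^2 + ζ^3 + 3*ζ^4 + 2*ζ^5, -1 - 2*ζ - 2*ζ^2 - 2*ζ^4, 0, 2 + ζ^3 + 2*ζ^4 + 2*ζ^5, -2 - 2*ζ - 2*ζ^2 - 4*ζ^3 - 3*ζ^4 - ζ^5] _ (by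
        intro e
        fin_cases e <;> simp [Fin.sum_univ_seven] <;> grind)]
    rw [qt_cc h7 5 16 _ _
      ![0, 0, 0, 0, 0, 0, 0] _ (by
        intro e
        fin_cases e <;> simp [Fin.sum_univ_seven] <;> grind)]
    exact qt_zero _

theorem statement_3 {k : Type*} [Field k] [IsAlgClosed k] [CharZero k]
    (ζ : k) (hζ : IsPrimitiveRoot ζ 7)
    (lam₁ lam₂ : k)
    (q : Fin 2 → Fin 2 → k) (hq : q = ![![ζ ^ 3, ζ], ![ζ ^ 3, ζ]]) :
    (1 : FreeAlgebra k (Fin 2)) ∉ TwoSidedIdeal.span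
      ({(bc q (ygen k 0) (bc q (ygen k 0) (ygen k 1))).1 - algebraMap k (FreeAlgebra k (Fin 2)) lam₁,
        (bc q (ygen k 1) (bc q (ygen k 1) (bc q (ygen k 1) (bc q (ygen k 1) (ygen k 0))))).1 - algebraMap k (FreeAlgebra k (Fin 2)) lam₂} : Set (FreeAlgebra k (Fin 2))) := by

  have h7 := hζ.pow_eq_one
  have hs := root_facts hζ
  have hn : ∀ m : ℕ, 0 < m → m < 7 → 1 - ζ ^ m ≠ 0 := fun m h0 hm h =>
    hζ.pow_ne_one_of_pos_of_lt h0.ne' hm (sub_eq_zero.mp h).symm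
  have n1 := hn 1 (by norm_num) (by norm_num)
  have n3 := hn 3 (by norm_num) (by norm_num)
  have n4 := hn 4 (by norm_num) (by norm_num)
  have n5 := hn 5 (by norm_num) (by norm_num)
  have n6 := hn 6 (by norm_num) (by norm_num)
  rw [pow_one] at n1
  have c1ne : (1 - ζ) * (1 - ζ ^ 4) ≠ 0 := mul_ne_zero n1 n4
  have c2ne : (1 - ζ ^ 3) * (1 - ζ ^ 4) * (1 - ζ ^ 5) * (1 - ζ ^ 6) ≠ 0 :=
    mul_ne_zero (mul_ne_zero (mul_ne_zero n3 n4) n5) n6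
  by_cases hl1 : lam₁ = 0
  · obtain ⟨A, B, hA, hB⟩ := rep_one h7 hs
    have hc : 3 + 2*ζ + 4*ζ^2 + 2*ζ^3 + 3*ζ^4 ≠ 0 := by
      intro h; apply c2ne; grind
    refine nontriv_of_rep ζ lam₁ lam₂ q hq
      ((lam₂ / (3 + 2*ζ + 4*ζ^2 + 2*ζ^3 + 3*ζ^4)) • A) B ?_ ?_
    · simp only [cc_smul_left, cc_smul_right, hA, smul_zero, hl1, zero_smul]
    · simp only [cc_smul_right, hB, smul_smul, div_mul_cancel₀ _ hc]
  by_cases hl2 : lam₂ = 0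
  · obtain ⟨A, B, hA, hB⟩ := rep_two h7 hs
    have hc : 1 - ζ - ζ^4 + ζ^5 ≠ 0 := by
      intro h; apply c1ne; grind
    refine nontriv_of_rep ζ lam₁ lam₂ q hq A ((lam₁ / (1 - ζ - ζ^4 + ζ^5)) • B) ?_ ?_
    · simp only [cc_smul_right, hA, smul_smul, div_mul_cancel₀ _ hc]
    · simp only [cc_smul_left, cc_smul_right, hB, smul_zero, hl2, zero_smul]
  · set c1 := (1 - ζ) * (1 - ζ ^ 4) with hc1
    set c2 := (1 - ζ ^ 3) * (1 - ζ ^ 4) * (1 - ζ ^ 5) * (1 - ζ ^ 6) with hc2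
    obtain ⟨a, ha⟩ := IsAlgClosed.exists_pow_nat_eq ((lam₁ / c1) ^ 4 / (lam₂ / c2))
      (n := 7) (by norm_num)
    have ha0 : a ≠ 0 := by
      rintro rfl
      have : (lam₁ / c1) ^ 4 / (lam₂ / c2) ≠ 0 :=
        div_ne_zero (pow_ne_zero _ (div_ne_zero hl1 c1ne)) (div_ne_zero hl2 c2ne)
      apply this; rw [← ha]; norm_num
    refine nontriv_of_rep ζ lam₁ lam₂ q hq a (lam₁ / c1 / a ^ 2) ?_ ?_
    · have : cc (ζ ^ 4) a (cc ζ a (lam₁ / c1 / a ^ 2)) = a ^ 2 * (lam₁ / c1 / a ^ 2) * c1 := by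
        simp only [cc, smul_eq_mul]; rw [hc1]; ring
      rw [this, smul_eq_mul]
      field_simp
    · generalize hb : lam₁ / c1 / a ^ 2 = b
      have : cc (ζ ^ 6) b (cc (ζ ^ 5) b (cc (ζ ^ 4) b (cc (ζ ^ 3) b a))) = a * b ^ 4 * c2 := by
        simp only [cc, smul_eq_mul]; rw [hc2]; ring
      rw [this, smul_eq_mul, ← hb, div_pow (lam₁ / c1)]
      have h8 : (lam₁ / c1) ^ 4 = a ^ 7 * (lam₂ / c2) := by
        rw [ha, div_mul_cancel₀ _ (div_ne_zero hl2 c2ne)]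
      rw [h8]
      field_simp
end

section
/- Let k be an algebraically closed field of characteristic 0 and ζ ∈ k a primitive 3rd root of unity. Let q be the 2×2 matrix with q_{11} = −1, q_{12} = ζ, q_{21} = −1, q_{22} = ζ (a braiding matrix of standard type B₂). Then for every μ₁, μ₂, λ ∈ k, the quotient of the free algebra k⟨y_1,y_2⟩ by the two-sided ideal generated by y_1² − μ₁, y_2³ − μ₂, and [y_{221}, y_{21}]_c − λ is a nontrivial algebra. -/
/-- Any nontrivial algebra with elements satisfying the relations witnesses nontriviality. -/
theorem notMem_of_rep {k : Type*} [Field k] {R : Type*} [Ring R] [Algebra k R] [Nontrivial R]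
    (ζ : k) (hz : ζ ^ 2 + ζ + 1 = 0) (μ₁ μ₂ lam : k)
    (q : Fin 2 → Fin 2 → k) (hq : q = ![![-1, ζ], ![-1, ζ]])
    (A B u w : R) (hA : A * A = μ₁ • (1 : R)) (hB : B * (B * B) = μ₂ • (1 : R))
    (hu : B * A + A * B = u) (hw : B * u + ζ • (u * B) = w)
    (hr : w * u + u * w = lam • (1 : R)) :
    (1 : FreeAlgebra k (Fin 2)) ∉ TwoSidedIdeal.span
      ({FreeAlgebra.ι k (0 : Fin 2) ^ 2 - algebraMap k (FreeAlgebra k (Fin 2)) μ₁,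
        FreeAlgebra.ι k (1 : Fin 2) ^ 3 - algebraMap k (FreeAlgebra k (Fin 2)) μ₂,
        (bc q (bc q (ygen k 1) (bc q (ygen k 1) (ygen k 0))) (bc q (ygen k 1) (ygen k 0))).1 - algebraMap k (FreeAlgebra k (Fin 2)) lam} : Set (FreeAlgebra k (Fin 2))) := by
  intro h
  let f : FreeAlgebra k (Fin 2) →ₐ[k] R := FreeAlgebra.lift k ![A, B]
  have hf0 : f (FreeAlgebra.ι k 0) = A := by simp [f]
  have hf1 : f (FreeAlgebra.ι k 1) = B := by simp [f]
  have h1 : (1 : FreeAlgebra k (Fin 2)) ∈ TwoSidedIdeal.ker f := by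
    refine (TwoSidedIdeal.span_le (I := TwoSidedIdeal.ker f)).2 ?_ h
    intro x hx
    rw [SetLike.mem_coe, TwoSidedIdeal.mem_ker]
    rcases hx with rfl | rfl | rfl
    · simp [hf0, pow_two, hA, Algebra.algebraMap_eq_smul_one]
    · simp [hf1, pow_succ, mul_assoc, hB, Algebra.algebraMap_eq_smul_one]
    · have e1 : f (bc q (ygen k 1) (ygen k 0)).1 = u := by
        simp [bc, ygen, qForm, hq, Fin.prod_univ_two, hf0, hf1, hu]
      have e2 : f (bc q (ygen k 1) (bc q (ygen k 1) (ygen k 0))).1 = w := by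
        have : (bc q (ygen k 1) (bc q (ygen k 1) (ygen k 0))).1
          = (ygen k 1).1 * (bc q (ygen k 1) (ygen k 0)).1
            + ζ • ((bc q (ygen k 1) (ygen k 0)).1 * (ygen k 1).1) := by
          simp [bc, ygen, qForm, hq, Fin.prod_univ_two]
        rw [this, map_add, map_smul, map_mul, map_mul, e1]
        simpa [ygen, hf1] using hw
      have h3 : ζ * ζ ^ 2 = 1 := by linear_combination (ζ - 1) * hz
      have e3 : (bc q (bc q (ygen k 1) (bc q (ygen k 1) (ygen k 0))) (bc q (ygen k 1) (ygen k 0))).1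
          = (bc q (ygen k 1) (bc q (ygen k 1) (ygen k 0))).1 * (bc q (ygen k 1) (ygen k 0)).1
            + (bc q (ygen k 1) (ygen k 0)).1 * (bc q (ygen k 1) (bc q (ygen k 1) (ygen k 0))).1 := by
        have : qForm q (bc q (ygen k 1) (bc q (ygen k 1) (ygen k 0))).2
            (bc q (ygen k 1) (ygen k 0)).2 = -1 := by
          simp [bc, ygen, qForm, hq, Fin.prod_univ_two]
          linear_combination h3
        rw [bc, this]
        simp
      rw [map_sub, e3, map_add, map_mul, map_mul, e1, e2, hr]
      simp [Algebra.algebraMap_eq_smul_one]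
  rw [TwoSidedIdeal.mem_ker] at h1
  simp at h1

set_option maxHeartbeats 20000000 in
theorem rep_zero {k : Type*} [Field k] (ζ : k) (hz : ζ ^ 2 + ζ + 1 = 0) (m l : k) :
    ∃ A B u w : Matrix (Fin 6) (Fin 6) k, A * A = m • (1 : Matrix (Fin 6) (Fin 6) k) ∧ B * (B * B) = (0 : k) • (1 : Matrix (Fin 6) (Fin 6) k) ∧
      B * A + A * B = u ∧ B * u + ζ • (u * B) = w ∧ w * u + u * w = l • (1 : Matrix (Fin 6) (Fin 6) k) := by
  refine ⟨!![0, m, 0, 0, 0, 0;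
    1, 0, 0, 0, 0, 0;
    0, 0, 0, 1, 0, 0;
    0, 0, m, 0, 0, 0;
    0, 0, 0, 0, 0, m;
    0, 0, 0, 0, 1, 0],
    !![0, 0, 0, 0, l, 0;
    0, 0, 0, 0, 0, -ζ * l - l;
    0, 0, 0, 0, 0, 0;
    0, 1, 0, 0, 0, 0;
    0, 0, 1, 0, 0, 0;
    0, 0, 0, 0, 0, 0],
    !![0, 0, 0, 0, 0, -ζ * l * m;
    0, 0, 0, 0, -ζ * l, 0;
    0, 1, 0, 0, 0, 0;
    1, 0, 0, 0, 0, 0;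
    0, 0, 0, 1, 0, 0;
    0, 0, 1, 0, 0, 0],
    !![0, 0, 0, l, 0, 0;
    0, 0, 0, 0, 0, 0;
    0, 0, 0, 0, 0, l;
    0, 0, 0, 0, 0, 0;
    0, ζ + 1, 0, 0, 0, 0;
    0, 0, 0, 0, 0, 0], ?_, ?_, ?_, ?_, ?_⟩ <;>
  · simp only [Matrix.mul_apply, Matrix.add_apply, Matrix.smul_apply, ← Matrix.ext_iff,
      Fin.forall_fin_succ, Fin.sum_univ_six]
    simp
    try grind

set_option maxHeartbeats 20000000 in
theorem rep_a {k : Type*} [Field k] (ζ : k) (hz : ζ ^ 2 + ζ + 1 = 0) (b a p q y : k) (h1 : 2 * a * q + p ^ 2 = 0) (h2 : 2 * a * p + q ^ 2 + y = 0) :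
    ∃ A B u w : Matrix (Fin 6) (Fin 6) k, A * A = (a ^ 2 + 2 * p * q) • (1 : Matrix (Fin 6) (Fin 6) k) ∧ B * (B * B) = (b ^ 3) • (1 : Matrix (Fin 6) (Fin 6) k) ∧
      B * A + A * B = u ∧ B * u + ζ • (u * B) = w ∧ w * u + u * w = ((-1 - ζ) * b ^ 3 * (2 * p * q - 8 * a ^ 2)) • (1 : Matrix (Fin 6) (Fin 6) k) := by
  refine ⟨!![a, 0, q, 1, p, 0;
    0, -a, y, -q, 0, -p;
    p, 0, a, 0, q, 1;
    0, -p, 0, -a, y, -q;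
    q, 1, p, 0, a, 0;
    y, -q, 0, -p, 0, -a],
    !![b, 0, 0, 0, 0, 0;
    0, b, 0, 0, 0, 0;
    0, 0, ζ * b, 0, 0, 0;
    0, 0, 0, ζ * b, 0, 0;
    0, 0, 0, 0, -ζ * b - b, 0;
    0, 0, 0, 0, 0, -ζ * b - b],
    !![2 * b * a, 0, ζ * b * q + b * q, ζ * b + b, -ζ * b * p, 0;
    0, -2 * b * a, ζ * b * y + b * y, -ζ * b * q - b * q, 0, ζ * b * p;
    ζ * b * p + b * p, 0, 2 * ζ * b * a, 0, -b * q, -b;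
    0, -ζ * b * p - b * p, 0, -2 * ζ * b * a, -b * y, b * q;
    -ζ * b * q, -ζ * b, -b * p, 0, -2 * ζ * b * a - 2 * b * a, 0;
    -ζ * b * y, ζ * b * q, 0, b * p, 0, 2 * ζ * b * a + 2 * b * a],
    !![2 * ζ * b^2 * a + 2 * b^2 * a, 0, b^2 * q, b^2, -2 * ζ * b^2 * p, 0;
    0, -2 * ζ * b^2 * a - 2 * b^2 * a, b^2 * y, -b^2 * q, 0, 2 * ζ * b^2 * p;
    -2 * b^2 * p, 0, -2 * ζ * b^2 * a, 0, -ζ * b^2 * q - b^2 * q, -ζ * b^2 - b^2;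
    0, 2 * b^2 * p, 0, 2 * ζ * b^2 * a, -ζ * b^2 * y - b^2 * y, ζ * b^2 * q + b^2 * q;
    ζ * b^2 * q, ζ * b^2, 2 * ζ * b^2 * p + 2 * b^2 * p, 0, -2 * b^2 * a, 0;
    ζ * b^2 * y, -ζ * b^2 * q, 0, -2 * ζ * b^2 * p - 2 * b^2 * p, 0, 2 * b^2 * a], ?_, ?_, ?_, ?_, ?_⟩ <;>
  · simp only [Matrix.mul_apply, Matrix.add_apply, Matrix.smul_apply, ← Matrix.ext_iff,
      Fin.forall_fin_succ, Fin.sum_univ_six]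
    simp
    try grind

set_option maxHeartbeats 20000000 in
theorem rep_b {k : Type*} [Field k] (ζ : k) (hz : ζ ^ 2 + ζ + 1 = 0) (b m : k) :
    ∃ A B u w : Matrix (Fin 6) (Fin 6) k, A * A = m • (1 : Matrix (Fin 6) (Fin 6) k) ∧ B * (B * B) = (b ^ 3) • (1 : Matrix (Fin 6) (Fin 6) k) ∧
      B * A + A * B = u ∧ B * u + ζ • (u * B) = w ∧ w * u + u * w = ((-1 - ζ) * b ^ 3 * m) • (1 : Matrix (Fin 6) (Fin 6) k) := by
  refine ⟨!![0, 0, 0, 0, 0, 1;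
    0, 0, m, 0, 0, 0;
    0, 1, 0, 0, 0, 0;
    0, 0, 0, 0, m, 0;
    0, 0, 0, 1, 0, 0;
    m, 0, 0, 0, 0, 0],
    !![b, 0, 0, 0, 0, 0;
    0, b, 0, 0, 0, 0;
    0, 0, ζ * b, 0, 0, 0;
    0, 0, 0, ζ * b, 0, 0;
    0, 0, 0, 0, -ζ * b - b, 0;
    0, 0, 0, 0, 0, -ζ * b - b],
    !![0, 0, 0, 0, 0, -ζ * b;
    0, 0, ζ * b * m + b * m, 0, 0, 0;
    0, ζ * b + b, 0, 0, 0, 0;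
    0, 0, 0, 0, -b * m, 0;
    0, 0, 0, -b, 0, 0;
    -ζ * b * m, 0, 0, 0, 0, 0],
    !![0, 0, 0, 0, 0, -2 * ζ * b^2;
    0, 0, b^2 * m, 0, 0, 0;
    0, -2 * b^2, 0, 0, 0, 0;
    0, 0, 0, 0, -ζ * b^2 * m - b^2 * m, 0;
    0, 0, 0, 2 * ζ * b^2 + 2 * b^2, 0, 0;
    ζ * b^2 * m, 0, 0, 0, 0, 0], ?_, ?_, ?_, ?_, ?_⟩ <;>
  · simp only [Matrix.mul_apply, Matrix.add_apply, Matrix.smul_apply, ← Matrix.ext_iff,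
      Fin.forall_fin_succ, Fin.sum_univ_six]
    simp
    try grind

theorem statement_4 {k : Type*} [Field k] [IsAlgClosed k] [CharZero k]
    (ζ : k) (hζ : IsPrimitiveRoot ζ 3)
    (μ₁ μ₂ lam : k)
    (q : Fin 2 → Fin 2 → k) (hq : q = ![![-1, ζ], ![-1, ζ]]) :
    (1 : FreeAlgebra k (Fin 2)) ∉ TwoSidedIdeal.span
      ({FreeAlgebra.ι k (0 : Fin 2) ^ 2 - algebraMap k (FreeAlgebra k (Fin 2)) μ₁,
        FreeAlgebra.ι k (1 : Fin 2) ^ 3 - algebraMap k (FreeAlgebra k (Fin 2)) μ₂,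
        (bc q (bc q (ygen k 1) (bc q (ygen k 1) (ygen k 0))) (bc q (ygen k 1) (ygen k 0))).1 - algebraMap k (FreeAlgebra k (Fin 2)) lam} : Set (FreeAlgebra k (Fin 2))) := by
  have hz : ζ ^ 2 + ζ + 1 = 0 := by
    have h1 : ζ - 1 ≠ 0 := sub_ne_zero.2 (hζ.ne_one (by norm_num))
    have h2 : ζ ^ 3 = 1 := hζ.pow_eq_one
    apply mul_left_cancel₀ h1
    linear_combination h2
  by_cases hμ : μ₂ = 0
  · subst hμ
    obtain ⟨A, B, u, w, h1, h2, h3, h4, h5⟩ := rep_zero ζ hz μ₁ lam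
    exact notMem_of_rep ζ hz _ _ _ q hq A B u w h1 h2 h3 h4 h5
  obtain ⟨b, hb⟩ := IsAlgClosed.exists_pow_nat_eq μ₂ (n := 3) (by norm_num)
  obtain ⟨a, ha⟩ := IsAlgClosed.exists_pow_nat_eq ((μ₁ - ζ * lam / μ₂) / 9) (n := 2) (by norm_num)
  have ha2 : 9 * a ^ 2 * μ₂ = μ₁ * μ₂ - ζ * lam := by
    rw [ha]; field_simp
  by_cases ha0 : a = 0
  · subst ha0
    have hl : lam = (-1 - ζ) * b ^ 3 * μ₁ := by
      rw [hb]; linear_combination (-1 - ζ) * ha2 + lam * hz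
    obtain ⟨A, B, u, w, h1, h2, h3, h4, h5⟩ := rep_b ζ hz b μ₁
    rw [hb] at h2
    rw [← hl] at h5
    exact notMem_of_rep ζ hz _ _ _ q hq A B u w h1 h2 h3 h4 h5
  · obtain ⟨p, hp⟩ := IsAlgClosed.exists_pow_nat_eq (-a * (μ₁ - a ^ 2)) (n := 3) (by norm_num)
    obtain ⟨r, hr⟩ : ∃ r, 2 * a * r + p ^ 2 = 0 := ⟨-p ^ 2 / (2 * a), by field_simp; ring⟩
    have hm : a ^ 2 + 2 * p * r = μ₁ := by
      apply mul_left_cancel₀ ha0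
      linear_combination p * hr - hp
    have hl : lam = (-1 - ζ) * b ^ 3 * (2 * p * r - 8 * a ^ 2) := by
      rw [hb]; linear_combination (-1 - ζ) * ha2 + lam * hz + (-1 - ζ) * μ₂ * (-hm)
    obtain ⟨A, B, u, w, h1, h2, h3, h4, h5⟩ :=
      rep_a ζ hz b a p r (-(2 * a * p + r ^ 2)) hr (by ring)
    rw [hb] at h2
    rw [← hl] at h5
    rw [hm] at h1
    exact notMem_of_rep ζ hz _ _ _ q hq A B u w h1 h2 h3 h4 h5
end

section
/- Let k be an algebraically closed field of characteristic 0 and ζ ∈ k a primitive 8th root of unity. Let q be the 2×2 matrix with q_{11} = ζ, q_{12} = −1, q_{21} = ζ, q_{22} = −1 (a braiding matrix of standard type G₂). Then for every λ₁, λ₂, λ₃ ∈ k, the quotient of the free algebra k⟨y_1,y_2⟩ by the two-sided ideal generated by y_{11112} − λ₁, y_2² − λ₂, and [[y_{112}, y_{12}]_c, y_{12}]_c − λ₃ is a nontrivial algebra. -/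
set_option linter.all false
set_option linter.unusedVariables false
set_option linter.unusedSimpArgs false

/-- First family: the action of `y₁`. -/
def repAZ {k : Type*} [Field k] (ζ u t : k) : Matrix (Fin 8) (Fin 8) k :=
  !![1, 0, 0, 0, 0, 0, 0, 0;
    0, -ζ^3, 0, 0, 0, 0, 0, 0;
    0, 0, -ζ^2, 0, 0, 0, 0, 0;
    0, 0, 0, -ζ, 0, 0, 0, 0;
    0, 0, 0, 0, -1, 0, 0, 0;
    0, 0, 0, 0, 0, ζ^3, 0, 0;
    0, 0, 0, 0, 0, 0, ζ^2, 0;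
    0, 0, 0, 0, 0, 0, 0, ζ]

/-- First family: the action of `y₂`. -/
def repAY {k : Type*} [Field k] (ζ u t : k) : Matrix (Fin 8) (Fin 8) k :=
  !![1, 0, 0, 0, 2*t + 2*u*t - 2*ζ*u*t + 2*ζ^3*u*t, 4*t + 2*ζ*t - 2*ζ*u*t - 2*ζ^3*t + 2*ζ^3*u*t, 4*t - 2*u*t + 2*ζ*t - 2*ζ^3*t, 2*t;
    -2, -1, 0, 0, 0, -2*t - 2*u*t + 2*ζ*u*t - 2*ζ^3*u*t, -2*t, -2*t;
    2, 2, 1, 0, 0, 0, 2*t - 2*u*t - 2*ζ*t + 2*ζ*u*t + 2*ζ^3*t - 2*ζ^3*u*t, 4*t - 2*ζ*t + 2*ζ^3*t;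
    -2, -2*u, -2*u, -1, 0, 0, 0, -2*t - 2*u*t + 2*ζ*u*t - 2*ζ^3*u*t;
    2 - 2*u - 2*ζ + 2*ζ*u + 2*ζ^3 - 2*ζ^3*u, -2*ζ + 2*ζ*u + 2*ζ^3 - 2*ζ^3*u, 2*u, 2, 1, 0, 0, 0;
    0, -2 + 2*u + 2*ζ - 2*ζ*u - 2*ζ^3 + 2*ζ^3*u, -2, -2, -2, -1, 0, 0;
    0, 0, 2 + 2*u - 2*ζ*u + 2*ζ^3*u, 4 - 2*ζ + 2*ζ^3, 2, 2, 1, 0;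
    0, 0, 0, -2 + 2*u + 2*ζ - 2*ζ*u - 2*ζ^3 + 2*ζ^3*u, -2, -4 + 2*u - 2*ζ + 2*ζ^3, -4 + 2*u - 2*ζ + 2*ζ^3, -1]

/-- First family: the action of `y₁₂`. -/
def repAU {k : Type*} [Field k] (ζ u t : k) : Matrix (Fin 8) (Fin 8) k :=
  !![2, 0, 0, 0, 0, 2*t + 2*u*t + 2*ζ*t - 2*ζ*u*t + 2*ζ^2*t - 2*ζ^2*u*t + 2*ζ^3*t + 2*ζ^3*u*t, 4*t - 2*u*t + 4*ζ*t + 4*ζ^2*t - 2*ζ^2*u*t, 2*t + 2*ζ*t;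
    -2 + 2*ζ^3, 2*ζ^3, 0, 0, 0, 0, -2*ζ^2*t + 2*ζ^3*t, -2*ζ*t + 2*ζ^3*t;
    2 - 2*ζ^2, -2*ζ^2 - 2*ζ^3, -2*ζ^2, 0, 0, 0, 0, -2*t + 6*ζ*t - 6*ζ^2*t + 2*ζ^3*t;
    -2 + 2*ζ, 2*ζ*u + 2*ζ^3*u, 2*ζ*u + 2*ζ^2*u, 2*ζ, 0, 0, 0, 0;
    0, -2 + 2*u + 2*ζ - 2*ζ*u + 2*ζ^2 - 2*ζ^2*u - 2*ζ^3 + 2*ζ^3*u, -2*u - 2*ζ^2*u, -2 - 2*ζ, -2, 0, 0, 0;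
    0, 0, 2*ζ^2 - 2*ζ^3, 2*ζ - 2*ζ^3, 2 - 2*ζ^3, -2*ζ^3, 0, 0;
    0, 0, 0, 2 - 6*ζ + 6*ζ^2 - 2*ζ^3, -2 + 2*ζ^2, 2*ζ^2 + 2*ζ^3, 2*ζ^2, 0;
    0, 0, 0, 0, 2 - 2*ζ, -4*ζ + 2*ζ*u - 4*ζ^2 - 4*ζ^3 + 2*ζ^3*u, -2 - 6*ζ + 2*ζ*u - 6*ζ^2 + 2*ζ^2*u - 2*ζ^3, -2*ζ]

/-- First family: the action of `y₁₁₂`. -/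
def repAW {k : Type*} [Field k] (ζ u t : k) : Matrix (Fin 8) (Fin 8) k :=
  !![2 + 2*ζ, 0, 0, 0, 0, 0, -2*u*t + 2*ζ*u*t + 4*ζ^2*t - 2*ζ^2*u*t + 4*ζ^3*t - 2*ζ^3*u*t, 2*t + 2*ζ*t + 2*ζ^2*t + 2*ζ^3*t;
    -2 - 2*ζ + 2*ζ^2 + 2*ζ^3, 2*ζ^2 + 2*ζ^3, 0, 0, 0, 0, 0, -2*t - 2*ζ*t + 2*ζ^2*t - 2*ζ^3*t;
    -2 + 2*ζ - 2*ζ^2 - 2*ζ^3, -2 - 2*ζ - 2*ζ^2 - 2*ζ^3, -2 - 2*ζ, 0, 0, 0, 0, 0;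
    0, 2*u + 2*ζ*u - 2*ζ^2*u + 2*ζ^3*u, 2*u + 2*ζ*u - 2*ζ^2*u - 2*ζ^3*u, -2*ζ^2 - 2*ζ^3, 0, 0, 0, 0;
    0, 0, 2*u - 2*ζ*u + 2*ζ^2*u + 2*ζ^3*u, 2 + 2*ζ + 2*ζ^2 + 2*ζ^3, 2 + 2*ζ, 0, 0, 0;
    0, 0, 0, -2 - 2*ζ + 2*ζ^2 - 2*ζ^3, -2 - 2*ζ + 2*ζ^2 + 2*ζ^3, 2*ζ^2 + 2*ζ^3, 0, 0;
    0, 0, 0, 0, -2 + 2*ζ - 2*ζ^2 - 2*ζ^3, -2 - 2*ζ - 2*ζ^2 - 2*ζ^3, -2 - 2*ζ, 0;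
    0, 0, 0, 0, 0, 4 - 2*u + 4*ζ - 2*ζ*u + 2*ζ^2*u - 2*ζ^3*u, 8 - 2*u + 4*ζ - 2*ζ*u - 4*ζ^2 + 2*ζ^2*u - 8*ζ^3 + 2*ζ^3*u, -2*ζ^2 - 2*ζ^3]

/-- First family: the action of `y₁₁₁₂`. -/
def repAX {k : Type*} [Field k] (ζ u t : k) : Matrix (Fin 8) (Fin 8) k :=
  !![2 + 2*ζ + 2*ζ^2 + 2*ζ^3, 0, 0, 0, 0, 0, 0, 4*ζ^3*t;
    -4, -2 + 2*ζ + 2*ζ^2 + 2*ζ^3, 0, 0, 0, 0, 0, 0;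
    0, -4*ζ, -2 - 2*ζ + 2*ζ^2 + 2*ζ^3, 0, 0, 0, 0, 0;
    0, 0, -4*ζ^2*u, -2 - 2*ζ - 2*ζ^2 + 2*ζ^3, 0, 0, 0, 0;
    0, 0, 0, -4*ζ^3, -2 - 2*ζ - 2*ζ^2 - 2*ζ^3, 0, 0, 0;
    0, 0, 0, 0, 4, 2 - 2*ζ - 2*ζ^2 - 2*ζ^3, 0, 0;
    0, 0, 0, 0, 0, 4*ζ, 2 + 2*ζ - 2*ζ^2 - 2*ζ^3, 0;
    0, 0, 0, 0, 0, 0, 4*ζ + 8*ζ^2 - 4*ζ^2*u + 4*ζ^3, 2 + 2*ζ + 2*ζ^2 - 2*ζ^3]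

/-- First family: the action of `[y₁₁₂, y₁₂]_c`. -/
def repAT {k : Type*} [Field k] (ζ u t : k) : Matrix (Fin 8) (Fin 8) k :=
  !![4*ζ + 4*ζ^3, 0, 0, 8*t + 8*u*t - 16*ζ*t + 8*ζ*u*t + 24*ζ^2*t - 24*ζ^2*u*t - 16*ζ^3*t + 24*ζ^3*u*t, 8*t + 16*u*t + 8*ζ*t - 16*ζ*u*t - 8*ζ^3*t + 16*ζ^3*u*t, 16*t + 16*ζ*t + 8*ζ^2*t - 16*ζ^2*u*t - 8*ζ^3*t + 16*ζ^3*u*t, 16*t - 8*u*t + 16*ζ*t + 16*ζ^2*t - 8*ζ^2*u*t, 4*t + 4*ζ*t + 4*ζ^2*t + 4*ζ^3*t;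
    4 - 4*ζ - 4*ζ^2 - 4*ζ^3, 4 - 4*ζ^2, 0, 0, -8*t - 8*ζ*t + 16*ζ^2*t - 16*ζ^3*t, -8*t + 16*u*t - 8*ζ*t - 16*ζ*u*t - 8*ζ^2*t + 16*ζ^2*u*t, -4*t + 8*u*t - 12*ζ*t - 12*ζ^2*t - 4*ζ^3*t + 8*ζ^3*u*t, -8*ζ*t - 8*ζ^3*t;
    -8 + 8*ζ^2, -4 - 4*ζ + 4*ζ^2 + 4*ζ^3, -4*ζ + 4*ζ^3, 0, 0, -16*t + 8*u*t + 8*ζ*t + 8*ζ*u*t + 16*ζ^2*t - 24*ζ^2*u*t - 24*ζ^3*t + 24*ζ^3*u*t, 8*ζ^2*t, 8*t - 8*ζ*t + 8*ζ^2*t + 8*ζ^3*t;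
    4 - 4*ζ + 8*ζ*u + 4*ζ^2 - 8*ζ^2*u - 4*ζ^3, 8*ζ*u - 8*ζ^3*u, 4*u + 4*ζ*u + 4*ζ^2*u - 4*ζ^3*u, 4 + 4*ζ^2, 0, 0, 8*ζ*t - 8*ζ^2*u*t - 8*ζ^3*t + 8*ζ^3*u*t, -8*ζ^3*t;
    -8 + 16*u + 8*ζ - 16*ζ*u - 8*ζ^3 + 16*ζ^3*u, 8*ζ^2 - 16*ζ^2*u - 8*ζ^3 + 16*ζ^3*u, -8*u - 8*ζ^2*u, -4 - 4*ζ - 4*ζ^2 - 4*ζ^3, -4*ζ - 4*ζ^3, 0, 0, -8*t + 8*u*t + 16*ζ*t + 8*ζ*u*t - 8*ζ^2*t - 24*ζ^2*u*t + 24*ζ^3*u*t;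
    8 + 8*ζ - 16*ζ^2 + 16*ζ^3, -8 + 16*u + 8*ζ - 16*ζ*u - 8*ζ^2 + 16*ζ^2*u, -4 + 8*u + 4*ζ + 4*ζ^2 - 4*ζ^3 + 8*ζ^3*u, 8*ζ + 8*ζ^3, -4 + 4*ζ + 4*ζ^2 + 4*ζ^3, -4 + 4*ζ^2, 0, 0;
    0, 16 + 8*u - 8*ζ + 8*ζ*u - 24*ζ^2*u + 8*ζ^3 + 24*ζ^3*u, -8*ζ^2, -8 + 8*ζ - 8*ζ^2 - 8*ζ^3, 8 - 8*ζ^2, 4 + 4*ζ - 4*ζ^2 - 4*ζ^3, 4*ζ - 4*ζ^3, 0;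
    0, 0, 8 + 8*ζ^2 - 8*ζ^2*u + 8*ζ^3*u, 8*ζ^3, -12 - 4*ζ + 8*ζ*u + 4*ζ^2 - 8*ζ^2*u + 12*ζ^3, -16 - 16*ζ + 8*ζ*u + 16*ζ^3 - 8*ζ^3*u, -16 + 4*u - 16*ζ + 4*ζ*u - 8*ζ^2 + 4*ζ^2*u + 8*ζ^3 - 4*ζ^3*u, -4 - 4*ζ^2]

set_option maxHeartbeats 4000000 in
theorem repA_U {k : Type*} [Field k] (ζ u t : k) (hz : ζ ^ 4 = -1) :
    repAZ ζ u t * repAY ζ u t + repAY ζ u t * repAZ ζ u t = repAU ζ u t := by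
  ext i j
  fin_cases i <;> fin_cases j <;>
    simp only [repAU, repAZ, repAY, Matrix.mul_apply, Matrix.sub_apply, Matrix.add_apply,
      Matrix.smul_apply, Fin.sum_univ_eight, Matrix.of_apply, Matrix.cons_val, smul_eq_mul,
      Fin.reduceFinMk, Fin.zero_eta, Fin.mk_one, Fin.isValue, Matrix.one_apply,
      Fin.reduceEq, reduceIte]
  any_goals ring1
  · linear_combination (2*t - 2*u*t - 2*ζ^2*t + 2*ζ^2*u*t) * hz
  · linear_combination (-2*ζ*t) * hz
  · linear_combination (2*t - 2*ζ*t) * hz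
  · linear_combination (2 - 2*u - 2*ζ^2 + 2*ζ^2*u) * hz
  · linear_combination (-2 + 2*ζ) * hz
  · linear_combination (2*ζ^2) * hz
  · linear_combination (2 + 2*ζ) * hz

set_option maxHeartbeats 4000000 in
theorem repA_W {k : Type*} [Field k] (ζ u t : k) (hz : ζ ^ 4 = -1) :
    repAZ ζ u t * repAU ζ u t + ζ • (repAU ζ u t * repAZ ζ u t) = repAW ζ u t := by
  ext i j
  fin_cases i <;> fin_cases j <;>
    simp only [repAW, repAU, repAZ, Matrix.mul_apply, Matrix.sub_apply, Matrix.add_apply,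
      Matrix.smul_apply, Fin.sum_univ_eight, Matrix.of_apply, Matrix.cons_val, smul_eq_mul,
      Fin.reduceFinMk, Fin.zero_eta, Fin.mk_one, Fin.isValue, Matrix.one_apply,
      Fin.reduceEq, reduceIte]
  any_goals ring1
  · linear_combination (2*t + 2*u*t + 2*ζ*t - 2*ζ*u*t + 2*ζ^2*t - 2*ζ^2*u*t + 2*ζ^3*t + 2*ζ^3*u*t) * hz
  · linear_combination (4*t + 4*ζ*t - 2*ζ*u*t) * hz
  · linear_combination (2 - 2*ζ^2) * hz
  · linear_combination (-2*ζ^2 - 2*ζ^3) * hz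
  · linear_combination (2*t + 2*ζ*t - 2*ζ^2*t) * hz
  · linear_combination (2) * hz
  · linear_combination (2 + 2*ζ + 2*ζ^2 + 2*ζ^3) * hz
  · linear_combination (2 + 2*ζ) * hz
  · linear_combination (-2*u - 2*ζ*u - 2*ζ^3*u) * hz
  · linear_combination (-2*u - 2*ζ*u) * hz
  · linear_combination (2 - 2*u - 2*ζ + 2*ζ*u - 2*ζ^2 + 2*ζ^2*u + 2*ζ^3 - 2*ζ^3*u) * hz
  · linear_combination (2*ζ*u) * hz
  · linear_combination (2 + 2*ζ - 2*ζ^2) * hz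
  · linear_combination (2 - 2*ζ^2) * hz
  · linear_combination (-2*ζ^2 - 2*ζ^3) * hz
  · linear_combination (2) * hz
  · linear_combination (2 + 2*ζ + 2*ζ^2 + 2*ζ^3) * hz
  · linear_combination (2 + 2*ζ) * hz
  · linear_combination (-4 + 2*u - 4*ζ + 2*ζ*u - 4*ζ^2 - 4*ζ^3 + 2*ζ^3*u) * hz
  · linear_combination (-8 + 2*u - 6*ζ + 2*ζ*u - 2*ζ^2) * hz

set_option maxHeartbeats 4000000 in
theorem repA_X {k : Type*} [Field k] (ζ u t : k) (hz : ζ ^ 4 = -1) :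
    repAZ ζ u t * repAW ζ u t + ζ ^ 2 • (repAW ζ u t * repAZ ζ u t) = repAX ζ u t := by
  ext i j
  fin_cases i <;> fin_cases j <;>
    simp only [repAX, repAW, repAZ, Matrix.mul_apply, Matrix.sub_apply, Matrix.add_apply,
      Matrix.smul_apply, Fin.sum_univ_eight, Matrix.of_apply, Matrix.cons_val, smul_eq_mul,
      Fin.reduceFinMk, Fin.zero_eta, Fin.mk_one, Fin.isValue, Matrix.one_apply,
      Fin.reduceEq, reduceIte]
  any_goals ring1
  · linear_combination (-2*u*t + 2*ζ*u*t + 4*ζ^2*t - 2*ζ^2*u*t + 4*ζ^3*t - 2*ζ^3*u*t) * hz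
  · linear_combination (2*t + 2*ζ*t + 2*ζ^2*t) * hz
  · linear_combination (4 - 2*ζ^2) * hz
  · linear_combination (2 - 2*ζ - 2*ζ^2 - 2*ζ^3 - 2*ζ^4) * hz
  · linear_combination (4*ζ + 2*ζ^2 + 2*ζ^3 + 2*ζ^4) * hz
  · linear_combination (2 + 2*ζ) * hz
  · linear_combination (-2*ζ*u - 2*ζ^2*u + 2*ζ^3*u - 2*ζ^4*u) * hz
  · linear_combination (-2*ζ*u + 2*ζ^2*u + 2*ζ^3*u) * hz
  · linear_combination (2 + 2*ζ + 2*ζ^2) * hz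
  · linear_combination (-2*u + 2*ζ*u - 2*ζ^2*u - 2*ζ^3*u) * hz
  · linear_combination (-2 - 2*ζ - 2*ζ^2) * hz
  · linear_combination (-4 + 2*ζ^2) * hz
  · linear_combination (-2 + 2*ζ + 2*ζ^2 + 2*ζ^3 + 2*ζ^4) * hz
  · linear_combination (-4*ζ - 2*ζ^2 - 2*ζ^3 - 2*ζ^4) * hz
  · linear_combination (-2 - 2*ζ) * hz
  · linear_combination (4*ζ - 2*ζ*u + 4*ζ^2 - 2*ζ^2*u + 2*ζ^3*u - 2*ζ^4*u) * hz
  · linear_combination (4*ζ - 2*ζ*u - 4*ζ^2 + 2*ζ^2*u - 8*ζ^3 + 2*ζ^3*u) * hz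
  · linear_combination (-2 - 2*ζ - 2*ζ^2) * hz

set_option maxHeartbeats 4000000 in
theorem repA_T {k : Type*} [Field k] (ζ u t : k) (hz : ζ ^ 4 = -1) :
    repAW ζ u t * repAU ζ u t + ζ ^ 3 • (repAU ζ u t * repAW ζ u t) = repAT ζ u t := by
  ext i j
  fin_cases i <;> fin_cases j <;>
    simp only [repAT, repAW, repAU, Matrix.mul_apply, Matrix.sub_apply, Matrix.add_apply,
      Matrix.smul_apply, Fin.sum_univ_eight, Matrix.of_apply, Matrix.cons_val, smul_eq_mul,
      Fin.reduceFinMk, Fin.zero_eta, Fin.mk_one, Fin.isValue, Matrix.one_apply,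
      Fin.reduceEq, reduceIte]
  any_goals ring1
  · linear_combination (4) * hz
  · linear_combination (-8*t - 12*u*t + 16*ζ*t + 8*ζ*u*t - 16*ζ^2*t - 4*ζ^2*u*t - 4*ζ^3*t - 4*ζ^3*u*t + 8*ζ^4*u*t - 4*ζ^5*t - 4*ζ^5*u*t) * hz
  · linear_combination (-4*t - 12*u*t - 8*ζ*t + 12*ζ*u*t - 8*ζ^2*t - 12*ζ^3*t - 8*ζ^3*u*t + 4*ζ^4*u*t + 4*ζ^5*t + 4*ζ^5*u*t) * hz
  · linear_combination (-12*t + 4*u*t - 16*ζ*t + 4*ζ*u*t - 16*ζ^2*t + 8*ζ^2*u*t - 8*ζ^3*t - 8*ζ^3*u*t + 4*ζ^4*u*t + 4*ζ^5*t + 4*ζ^5*u*t) * hz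
  · linear_combination (-12*t + 4*u*t - 16*ζ*t - 28*ζ^2*t + 8*ζ^2*u*t - 16*ζ^3*t + 4*ζ^3*u*t) * hz
  · linear_combination (-4*ζ^2*t - 4*ζ^3*t) * hz
  · linear_combination (-8 + 4*ζ^2 + 4*ζ^4 + 4*ζ^5) * hz
  · linear_combination (-4 + 4*ζ^2 + 4*ζ^4 + 4*ζ^5) * hz
  · linear_combination (4*t + 8*ζ*t - 8*ζ^2*t + 8*ζ^3*t - 4*ζ^5*t) * hz
  · linear_combination (4*t - 20*u*t + 8*ζ*t + 12*ζ*u*t + 20*ζ^2*t - 8*ζ^2*u*t + 8*ζ^3*t + 4*ζ^4*u*t - 4*ζ^5*t - 4*ζ^5*u*t) * hz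
  · linear_combination (-4*u*t + 12*ζ*t + 24*ζ^2*t - 8*ζ^2*u*t + 20*ζ^3*t - 4*ζ^3*u*t - 8*ζ^5*t) * hz
  · linear_combination (-4*t + 4*ζ*t + 4*ζ^2*t + 4*ζ^3*t + 4*ζ^4*t - 4*ζ^5*t) * hz
  · linear_combination (4 + 4*ζ - 4*ζ^2 + 4*ζ^3 - 4*ζ^4 - 4*ζ^5) * hz
  · linear_combination (4 + 4*ζ - 4*ζ^4 - 4*ζ^5) * hz
  · linear_combination (4*ζ + 4*ζ^2) * hz
  · linear_combination (12*t - 12*u*t - 8*ζ*t - 20*ζ^2*t + 20*ζ^2*u*t + 8*ζ^3*t - 28*ζ^3*u*t + 16*ζ^4*u*t - 4*ζ^5*u*t) * hz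
  · linear_combination (-8*t + 4*u*t - 4*ζ*u*t - 12*ζ^2*t + 8*ζ^2*u*t - 24*ζ^3*t + 32*ζ^4*t - 4*ζ^4*u*t - 16*ζ^5*t + 4*ζ^5*u*t) * hz
  · linear_combination (-8*t + 4*ζ*t - 4*ζ^2*t - 4*ζ^3*t + 4*ζ^4*t) * hz
  · linear_combination (-4 + 4*ζ - 8*ζ*u + 4*ζ^2*u - 8*ζ^3*u + 4*ζ^5*u) * hz
  · linear_combination (-8*ζ*u - 4*ζ^2*u + 4*ζ^5*u) * hz
  · linear_combination (-4*u - 4*ζ*u - 8*ζ^2*u - 4*ζ^3*u) * hz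
  · linear_combination (-4 - 4*ζ^2 - 4*ζ^3) * hz
  · linear_combination (-8*ζ*t + 4*ζ^2*u*t + 8*ζ^3*t - 4*ζ^3*u*t) * hz
  · linear_combination (-4*u*t + 4*ζ*u*t + 4*ζ^3*t - 8*ζ^3*u*t + 4*ζ^4*u*t - 4*ζ^5*u*t) * hz
  · linear_combination (4 - 12*u - 8*ζ + 12*ζ*u + 12*ζ^3 - 8*ζ^3*u + 4*ζ^4*u - 4*ζ^5 + 4*ζ^5*u) * hz
  · linear_combination (-4 + 4*u + 4*ζ*u + 8*ζ^2*u + 8*ζ^3 - 8*ζ^3*u + 4*ζ^4*u - 4*ζ^5 + 4*ζ^5*u) * hz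
  · linear_combination (4*u + 8*ζ^2*u + 4*ζ^3*u) * hz
  · linear_combination (4*ζ^2 + 4*ζ^3) * hz
  · linear_combination (-4) * hz
  · linear_combination (8*t - 12*u*t - 16*ζ*t + 8*ζ*u*t + 8*ζ^2*t - 4*ζ^2*u*t + 4*ζ^3*t - 4*ζ^3*u*t - 8*ζ^4*t + 8*ζ^4*u*t + 4*ζ^5*t - 4*ζ^5*u*t) * hz
  · linear_combination (-4 - 8*ζ + 8*ζ^2 - 8*ζ^3 + 4*ζ^5) * hz
  · linear_combination (12 - 20*u - 8*ζ + 12*ζ*u - 4*ζ^2 - 8*ζ^2*u + 4*ζ^4*u + 4*ζ^5 - 4*ζ^5*u) * hz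
  · linear_combination (4 - 4*u - 4*ζ - 4*ζ^2 - 8*ζ^2*u + 4*ζ^3 - 4*ζ^3*u) * hz
  · linear_combination (4 - 4*ζ - 4*ζ^2 - 4*ζ^3 - 4*ζ^4 + 4*ζ^5) * hz
  · linear_combination (8 - 4*ζ^2 - 4*ζ^4 - 4*ζ^5) * hz
  · linear_combination (4 - 4*ζ^2 - 4*ζ^4 - 4*ζ^5) * hz
  · linear_combination (-12 - 12*u + 4*ζ^2 + 20*ζ^2*u - 28*ζ^3*u + 16*ζ^4*u - 4*ζ^5*u) * hz
  · linear_combination (4*u - 4*ζ*u + 4*ζ^2 + 8*ζ^2*u - 4*ζ^4*u + 4*ζ^5*u) * hz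
  · linear_combination (8 - 4*ζ + 4*ζ^2 + 4*ζ^3 - 4*ζ^4) * hz
  · linear_combination (-4 - 4*ζ + 4*ζ^2 - 4*ζ^3 + 4*ζ^4 + 4*ζ^5) * hz
  · linear_combination (-4 - 4*ζ + 4*ζ^4 + 4*ζ^5) * hz
  · linear_combination (-4*ζ - 4*ζ^2) * hz
  · linear_combination (-8 + 4*ζ^2*u - 4*ζ^3*u) * hz
  · linear_combination (16 - 4*u - 32*ζ + 4*ζ*u + 24*ζ^2 + 4*ζ^3 - 8*ζ^3*u + 4*ζ^4*u + 8*ζ^5 - 4*ζ^5*u) * hz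
  · linear_combination (4 + 4*ζ - 8*ζ*u + 16*ζ^2 + 4*ζ^2*u + 12*ζ^3 - 8*ζ^3*u - 4*ζ^5 + 4*ζ^5*u) * hz
  · linear_combination (16 + 16*ζ - 8*ζ*u + 16*ζ^2 - 4*ζ^2*u + 12*ζ^3 - 4*ζ^5 + 4*ζ^5*u) * hz
  · linear_combination (16 - 4*u + 16*ζ - 4*ζ*u + 28*ζ^2 - 8*ζ^2*u + 20*ζ^3 - 4*ζ^3*u) * hz
  · linear_combination (4 + 4*ζ^2 + 4*ζ^3) * hz

set_option maxHeartbeats 4000000 in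
theorem repA_rel1 {k : Type*} [Field k] (ζ u t : k) (hz : ζ ^ 4 = -1) :
    repAZ ζ u t * repAX ζ u t + ζ ^ 3 • (repAX ζ u t * repAZ ζ u t) =
      (4 * ζ ^ 3) • (1 : Matrix (Fin 8) (Fin 8) k) := by
  ext i j
  fin_cases i <;> fin_cases j <;>
    simp only [repAX, repAZ, Matrix.mul_apply, Matrix.sub_apply, Matrix.add_apply,
      Matrix.smul_apply, Fin.sum_univ_eight, Matrix.of_apply, Matrix.cons_val, smul_eq_mul,
      Fin.reduceFinMk, Fin.zero_eta, Fin.mk_one, Fin.isValue, Matrix.one_apply,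
      Fin.reduceEq, reduceIte]
  any_goals ring1
  · linear_combination (2 + 2*ζ + 2*ζ^2) * hz
  · linear_combination (4*ζ^3*t) * hz
  · linear_combination (-2*ζ^3 - 2*ζ^4 - 2*ζ^5) * hz
  · linear_combination (4*ζ^3) * hz
  · linear_combination (2*ζ^2 - 2*ζ^3 - 2*ζ^4) * hz
  · linear_combination (4*ζ^3*u) * hz
  · linear_combination (2*ζ + 2*ζ^2 - 2*ζ^3) * hz
  · linear_combination (4*ζ^3) * hz
  · linear_combination (2 + 2*ζ + 2*ζ^2) * hz
  · linear_combination (-2*ζ^3 - 2*ζ^4 - 2*ζ^5) * hz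
  · linear_combination (4*ζ^3) * hz
  · linear_combination (2*ζ^2 - 2*ζ^3 - 2*ζ^4) * hz
  · linear_combination (4*ζ^2 + 8*ζ^3 - 4*ζ^3*u + 4*ζ^4) * hz
  · linear_combination (2*ζ + 2*ζ^2 - 2*ζ^3) * hz

set_option maxHeartbeats 4000000 in
theorem repA_rel2 {k : Type*} [Field k] (ζ u t : k) (hz : ζ ^ 4 = -1) :
    repAY ζ u t * repAY ζ u t =
      (1 + 4 * (1 + (ζ ^ 3 - ζ)) * t +
        4 * (1 + (ζ ^ 3 - ζ)) ^ 2 * (u * (2 - (ζ ^ 3 - ζ) - u)) * t) • (1 : Matrix (Fin 8) (Fin 8) k) := by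
  ext i j
  fin_cases i <;> fin_cases j <;>
    simp only [repAY, Matrix.mul_apply, Matrix.sub_apply, Matrix.add_apply,
      Matrix.smul_apply, Fin.sum_univ_eight, Matrix.of_apply, Matrix.cons_val, smul_eq_mul,
      Fin.reduceFinMk, Fin.zero_eta, Fin.mk_one, Fin.isValue, Matrix.one_apply,
      Fin.reduceEq, reduceIte]
  any_goals ring1
  · linear_combination (-8*u*t + 8*ζ*u*t + 4*ζ^2*u*t - 12*ζ^3*u*t + 4*ζ^5*u*t) * hz
  · linear_combination (-8*t + 8*u*t + 4*ζ^2*t - 4*ζ^2*u*t) * hz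
  · linear_combination (8*u*t - 4*ζ^2*u*t) * hz
  · linear_combination (8*t - 4*ζ^2*t) * hz
  · linear_combination (-8*u*t + 8*ζ*u*t + 4*ζ^2*u*t - 12*ζ^3*u*t + 4*ζ^5*u*t) * hz
  · linear_combination (-8*u*t + 8*ζ*u*t + 4*ζ^2*u*t - 12*ζ^3*u*t + 4*ζ^5*u*t) * hz
  · linear_combination (-8*t + 4*ζ^2*t) * hz
  · linear_combination (-8*t + 4*ζ^2*t) * hz
  · linear_combination (-8*u*t + 8*ζ*u*t + 4*ζ^2*u*t - 12*ζ^3*u*t + 4*ζ^5*u*t) * hz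
  · linear_combination (8*u*t - 4*ζ^2*u*t) * hz
  · linear_combination (8*u*t - 4*ζ^2*u*t) * hz
  · linear_combination (-8*u*t + 8*ζ*u*t + 4*ζ^2*u*t - 12*ζ^3*u*t + 4*ζ^5*u*t) * hz
  · linear_combination (8*t - 8*u*t - 4*ζ^2*t + 4*ζ^2*u*t) * hz
  · linear_combination (8*t - 8*u*t - 4*ζ^2*t + 4*ζ^2*u*t) * hz
  · linear_combination (-8*u*t + 8*ζ*u*t + 4*ζ^2*u*t - 12*ζ^3*u*t + 4*ζ^5*u*t) * hz
  · linear_combination (-8*u*t + 8*ζ*u*t + 4*ζ^2*u*t - 12*ζ^3*u*t + 4*ζ^5*u*t) * hz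
  · linear_combination (8 - 8*u - 4*ζ^2 + 4*ζ^2*u) * hz
  · linear_combination (-8*u + 4*ζ^2*u) * hz
  · linear_combination (-8 + 4*ζ^2) * hz
  · linear_combination (-8*u*t + 8*ζ*u*t + 4*ζ^2*u*t - 12*ζ^3*u*t + 4*ζ^5*u*t) * hz

set_option maxHeartbeats 4000000 in
theorem repA_rel3 {k : Type*} [Field k] (ζ u t : k) (hz : ζ ^ 4 = -1) :
    repAT ζ u t * repAU ζ u t - ζ • (repAU ζ u t * repAT ζ u t) =
      (8 * (2 + (ζ ^ 3 - ζ)) * (1 + ζ) * (1 + 2 * (1 + (ζ ^ 3 - ζ)) ^ 2 * t)) • (1 : Matrix (Fin 8) (Fin 8) k) := by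
  ext i j
  fin_cases i <;> fin_cases j <;>
    simp only [repAT, repAU, Matrix.mul_apply, Matrix.sub_apply, Matrix.add_apply,
      Matrix.smul_apply, Fin.sum_univ_eight, Matrix.of_apply, Matrix.cons_val, smul_eq_mul,
      Fin.reduceFinMk, Fin.zero_eta, Fin.mk_one, Fin.isValue, Matrix.one_apply,
      Fin.reduceEq, reduceIte]
  any_goals ring1
  · linear_combination (-16 - 48*t - 16*u*t + 80*ζ*t - 16*ζ*u*t - 96*ζ^2*t + 64*ζ^2*u*t - 48*ζ^3*t - 32*ζ^3*u*t + 48*ζ^4*t - 16*ζ^5*t - 16*ζ^6*t) * hz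
  · linear_combination (-16*t - 16*u*t + 32*u^2*t - 48*ζ*t + 64*ζ*u*t - 64*ζ*u^2*t - 176*ζ^2*u*t + 96*ζ^2*u^2*t) * hz
  · linear_combination (-16*u*t - 32*u^2*t - 8*ζ*t - 8*ζ*u*t + 32*ζ*u^2*t + 16*ζ^2*t - 64*ζ^2*u*t + 16*ζ^2*u^2*t + 8*ζ^3*t - 8*ζ^3*u*t - 16*ζ^3*u^2*t) * hz
  · linear_combination (16*t - 48*u*t - 32*ζ*t + 32*ζ*u*t + 32*ζ^2*t - 32*ζ^2*u*t - 16*ζ^3*t - 16*ζ^3*u*t) * hz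
  · linear_combination (-8*t - 16*u*t - 32*ζ*t + 24*ζ*u*t - 32*ζ^2*u*t - 8*ζ^3*t - 8*ζ^3*u*t) * hz
  · linear_combination (-16*ζ*t + 32*ζ*u*t + 16*ζ^2*t - 32*ζ^2*u*t) * hz
  · linear_combination (-8*t - 16*ζ*t + 8*ζ*u*t + 8*ζ^2*t - 8*ζ^2*u*t) * hz
  · linear_combination (-8*ζ + 8*ζ^2) * hz
  · linear_combination (-16 - 16*t - 16*u*t - 8*ζ + 48*ζ*t + 8*ζ^2 - 48*ζ^2*t + 64*ζ^2*u*t - 32*ζ^3*t - 48*ζ^3*u*t + 48*ζ^4*t - 16*ζ^5*t - 16*ζ^6*t) * hz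
  · linear_combination (16*u*t + 16*ζ*u*t + 16*ζ^2*u*t - 16*ζ^3*u*t) * hz
  · linear_combination (8*t + 16*u*t + 32*ζ*t - 40*ζ^2*t + 32*ζ^2*u*t + 32*ζ^3*t - 48*ζ^3*u*t) * hz
  · linear_combination (8*t + 16*u*t + 24*ζ*t - 24*ζ^2*t + 16*ζ^2*u*t + 24*ζ^3*t - 32*ζ^3*u*t) * hz
  · linear_combination (8*t + 8*u*t + 32*ζ*t - 16*ζ*u*t + 16*ζ^2*t - 8*ζ^2*u*t - 8*ζ^3*t - 16*ζ^3*u*t) * hz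
  · linear_combination (16*t - 8*u*t + 48*ζ*t - 8*ζ*u*t + 16*ζ^2*t + 8*ζ^2*u*t - 8*ζ^3*u*t) * hz
  · linear_combination (8*t + 8*ζ^3*t) * hz
  · linear_combination (-8 - 8*ζ^3) * hz
  · linear_combination (-16 - 32*t - 8*ζ + 64*ζ*t + 8*ζ^2 - 64*ζ^2*t + 16*ζ^2*u*t - 16*ζ^3*t - 16*ζ^3*u*t + 48*ζ^4*t - 16*ζ^5*t - 16*ζ^6*t) * hz
  · linear_combination (-48*ζ*t + 64*ζ^2*t - 16*ζ^3*t) * hz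
  · linear_combination (-16*t + 16*u*t - 56*ζ*t - 16*ζ*u*t + 96*ζ^2*t - 56*ζ^3*t) * hz
  · linear_combination (-16*t - 16*u*t - 112*ζ*t + 32*ζ*u*t + 32*ζ^2*t + 32*ζ^2*u*t - 32*ζ^3*t + 16*ζ^3*u*t) * hz
  · linear_combination (-48*t + 16*u*t - 128*ζ*t + 40*ζ*u*t + 24*ζ^2*t - 16*ζ^2*u*t - 24*ζ^3*t + 24*ζ^3*u*t) * hz
  · linear_combination (-16*t - 32*ζ*t + 32*ζ^2*t - 16*ζ^3*t) * hz
  · linear_combination (8*u + 8*ζ*u - 8*ζ^2*u + 8*ζ^3*u) * hz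
  · linear_combination (8*ζ*u - 8*ζ^2*u) * hz
  · linear_combination (8*ζ*u - 8*ζ^2*u) * hz
  · linear_combination (-16 - 32*t + 80*ζ*t + 16*ζ*u*t - 80*ζ^2*t - 16*ζ^2*u*t - 16*ζ^3*t + 48*ζ^4*t - 16*ζ^5*t - 16*ζ^6*t) * hz
  · linear_combination (32*ζ*u*t - 32*ζ^2*u*t + 32*ζ^3*u*t) * hz
  · linear_combination (8*t + 8*u*t + 32*ζ*t + 16*ζ*u^2*t + 8*ζ^2*t + 56*ζ^2*u*t - 80*ζ^2*u^2*t) * hz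
  · linear_combination (16*t - 8*u*t + 32*ζ*t + 24*ζ*u*t - 16*ζ*u^2*t + 16*ζ^2*t + 8*ζ^2*u*t + 8*ζ^3*u*t - 16*ζ^3*u^2*t) * hz
  · linear_combination (8*t - 8*u*t + 8*ζ*t + 32*ζ*u*t - 40*ζ^2*u*t + 16*ζ^3*u*t) * hz
  · linear_combination (-8 + 16*u + 16*ζ - 24*ζ*u - 16*ζ^2 + 32*ζ^2*u - 8*ζ^3 + 8*ζ^3*u) * hz
  · linear_combination (16*ζ - 32*ζ*u - 16*ζ^2 + 32*ζ^2*u) * hz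
  · linear_combination (-8*ζ*u + 8*ζ^2*u) * hz
  · linear_combination (-16 - 48*t + 16*u*t + 80*ζ*t + 16*ζ*u*t - 32*ζ^2*t - 64*ζ^2*u*t - 48*ζ^3*t + 32*ζ^3*u*t + 48*ζ^4*t - 16*ζ^5*t - 16*ζ^6*t) * hz
  · linear_combination (-16*t + 16*u*t + 32*u^2*t + 16*ζ*t - 64*ζ*u^2*t - 32*ζ^2*t - 80*ζ^2*u*t + 96*ζ^2*u^2*t) * hz
  · linear_combination (-16*t + 64*u*t - 32*u^2*t + 8*ζ*t - 72*ζ*u*t + 32*ζ*u^2*t - 32*ζ^2*t - 16*ζ^2*u*t + 16*ζ^2*u^2*t - 8*ζ^3*t + 24*ζ^3*u*t - 16*ζ^3*u^2*t) * hz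
  · linear_combination (-16*t + 48*u*t - 32*ζ*u*t + 32*ζ^2*u*t - 16*ζ^3*t + 16*ζ^3*u*t) * hz
  · linear_combination (24 - 16*u + 8*ζ - 8*ζ^2 - 16*ζ^2*u + 8*ζ^3 + 32*ζ^3*u) * hz
  · linear_combination (8 - 8*u - 16*ζ + 16*ζ*u + 8*ζ^2*u - 8*ζ^3 + 16*ζ^3*u) * hz
  · linear_combination (8*u + 8*ζ*u - 8*ζ^2*u + 8*ζ^3*u) * hz
  · linear_combination (8 + 8*ζ^3) * hz
  · linear_combination (-8*ζ + 8*ζ^2) * hz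
  · linear_combination (-16 - 16*t + 16*u*t - 8*ζ + 80*ζ*t + 8*ζ^2 + 16*ζ^2*t - 64*ζ^2*u*t - 64*ζ^3*t + 48*ζ^3*u*t + 48*ζ^4*t - 16*ζ^5*t - 16*ζ^6*t) * hz
  · linear_combination (32*t - 16*u*t + 64*ζ*t - 16*ζ*u*t + 16*ζ^2*t - 16*ζ^2*u*t - 16*ζ^3*t + 16*ζ^3*u*t) * hz
  · linear_combination (24*t - 16*u*t + 32*ζ*t - 24*ζ^2*t - 32*ζ^2*u*t + 48*ζ^3*u*t) * hz
  · linear_combination (-16 - 16*u - 40*ζ + 16*ζ*u + 64*ζ^2 - 40*ζ^3) * hz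
  · linear_combination (-16 + 16*u + 16*ζ - 32*ζ*u + 32*ζ^2 - 32*ζ^2*u - 16*ζ^3*u) * hz
  · linear_combination (-16*u - 40*ζ*u + 8*ζ^2 + 16*ζ^2*u + 8*ζ^3 - 24*ζ^3*u) * hz
  · linear_combination (-16 - 32*ζ + 32*ζ^2 - 16*ζ^3) * hz
  · linear_combination (-8 - 8*ζ^3) * hz
  · linear_combination (-16 - 32*t - 8*ζ + 48*ζ*t + 8*ζ^2 - 32*ζ^2*t - 16*ζ^2*u*t - 32*ζ^3*t + 16*ζ^3*u*t + 48*ζ^4*t - 16*ζ^5*t - 16*ζ^6*t) * hz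
  · linear_combination (-48*ζ*t + 64*ζ^2*t - 16*ζ^3*t) * hz
  · linear_combination (16 + 16*ζ - 32*ζ*u + 32*ζ^2*u + 64*ζ^3 - 32*ζ^3*u) * hz
  · linear_combination (24 - 24*u + 16*ζ + 16*ζ*u + 16*ζ*u^2 - 8*ζ^2 + 184*ζ^2*u - 80*ζ^2*u^2 + 16*ζ^3 + 48*ζ^3*u) * hz
  · linear_combination (24*u + 24*ζ*u - 16*ζ*u^2 - 48*ζ^2 + 40*ζ^2*u - 16*ζ^3 + 40*ζ^3*u - 16*ζ^3*u^2) * hz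
  · linear_combination (-8 + 8*u + 56*ζ - 32*ζ*u - 80*ζ^2 + 40*ζ^2*u + 16*ζ^3 - 16*ζ^3*u) * hz
  · linear_combination (16 - 8*u + 32*ζ - 8*ζ*u - 16*ζ^2 + 8*ζ^2*u + 16*ζ^3 - 8*ζ^3*u) * hz
  · linear_combination (24*ζ - 8*ζ*u - 32*ζ^2 + 8*ζ^2*u - 8*ζ^3) * hz
  · linear_combination (8 + 24*ζ - 8*ζ*u - 24*ζ^2 + 8*ζ^2*u - 8*ζ^3) * hz
  · linear_combination (-16 - 48*t + 112*ζ*t - 16*ζ*u*t - 96*ζ^2*t + 16*ζ^2*u*t - 16*ζ^3*t + 48*ζ^4*t - 16*ζ^5*t - 16*ζ^6*t) * hz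

/-- Second family: the action of `y₁`. -/
def repBZ {k : Type*} [Field k] (ζ u t : k) : Matrix (Fin 8) (Fin 8) k :=
  !![0, 0, 0, 0, 0, 0, 0, 0;
    0, 0, 0, 0, 0, 0, 0, 0;
    0, 0, 0, 0, 0, 0, 0, 0;
    -ζ^3*t, 0, 0, 0, 0, 0, 0, 0;
    0, 1, 0, 0, 0, 0, 0, 0;
    0, 0, 1, 0, 0, 0, 0, 0;
    0, 0, 0, 1, 0, 0, 0, 0;
    0, 0, 0, 0, t, 0, 0, 0]

/-- Second family: the action of `y₂`. -/
def repBY {k : Type*} [Field k] (ζ u t : k) : Matrix (Fin 8) (Fin 8) k :=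
  !![0, 0, 0, 0, 1, 0, 0, 0;
    0, 0, 0, 0, 0, 1, 0, 0;
    0, 0, 0, 0, 0, 0, 1, 0;
    0, 0, 0, 0, 0, 0, 0, 1;
    u, 0, 0, 0, 0, 0, 0, 0;
    0, u, 0, 0, 0, 0, 0, 0;
    0, 0, u, 0, 0, 0, 0, 0;
    0, 0, 0, u, 0, 0, 0, 0]

/-- Second family: the action of `y₁₂`. -/
def repBU {k : Type*} [Field k] (ζ u t : k) : Matrix (Fin 8) (Fin 8) k :=
  !![0, 1, 0, 0, 0, 0, 0, 0;
    0, 0, 1, 0, 0, 0, 0, 0;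
    0, 0, 0, 1, 0, 0, 0, 0;
    0, 0, 0, 0, t - ζ^3*t, 0, 0, 0;
    0, 0, 0, 0, 0, 1, 0, 0;
    0, 0, 0, 0, 0, 0, 1, 0;
    0, 0, 0, 0, 0, 0, 0, 1;
    u*t - ζ^3*u*t, 0, 0, 0, 0, 0, 0, 0]

/-- Second family: the action of `y₁₁₂`. -/
def repBW {k : Type*} [Field k] (ζ u t : k) : Matrix (Fin 8) (Fin 8) k :=
  !![0, 0, 0, 0, 0, 0, 0, 0;
    0, 0, 0, 0, 0, 0, 0, 0;
    t, 0, 0, 0, 0, 0, 0, 0;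
    0, t + ζ*t - ζ^3*t, 0, 0, 0, 0, 0, 0;
    0, 0, 1 + ζ, 0, 0, 0, 0, 0;
    0, 0, 0, 1 + ζ, 0, 0, 0, 0;
    0, 0, 0, 0, t + ζ*t - ζ^3*t, 0, 0, 0;
    0, 0, 0, 0, 0, t, 0, 0]

/-- Second family: the action of `y₁₁₁₂`. -/
def repBX {k : Type*} [Field k] (ζ u t : k) : Matrix (Fin 8) (Fin 8) k :=
  !![0, 0, 0, 0, 0, 0, 0, 0;
    0, 0, 0, 0, 0, 0, 0, 0;
    0, 0, 0, 0, 0, 0, 0, 0;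
    0, 0, 0, 0, 0, 0, 0, 0;
    0, 0, 0, 0, 0, 0, 0, 0;
    t + ζ*t + ζ^2*t, 0, 0, 0, 0, 0, 0, 0;
    0, t + 2*ζ*t + ζ^2*t, 0, 0, 0, 0, 0, 0;
    0, 0, t + ζ*t + ζ^2*t, 0, 0, 0, 0, 0]

/-- Second family: the action of `[y₁₁₂, y₁₂]_c`. -/
def repBT {k : Type*} [Field k] (ζ u t : k) : Matrix (Fin 8) (Fin 8) k :=
  !![0, 0, 0, 0, 0, 0, 0, 0;
    ζ^3*t, 0, 0, 0, 0, 0, 0, 0;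
    0, ζ^2*t + ζ^3*t, 0, 0, 0, 0, 0, 0;
    0, 0, ζ*t + ζ^2*t + ζ^3*t, 0, 0, 0, 0, 0;
    0, 0, 0, ζ + ζ^3, 0, 0, 0, 0;
    0, 0, 0, 0, t + ζ*t + ζ^2*t, 0, 0, 0;
    0, 0, 0, 0, 0, t + ζ*t, 0, 0;
    0, 0, 0, 0, 0, 0, t, 0]

set_option maxHeartbeats 4000000 in
theorem repB_U {k : Type*} [Field k] (ζ u t : k) (hz : ζ ^ 4 = -1) :
    repBZ ζ u t * repBY ζ u t + repBY ζ u t * repBZ ζ u t = repBU ζ u t := by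
  ext i j
  fin_cases i <;> fin_cases j <;>
    simp only [repBU, repBZ, repBY, Matrix.mul_apply, Matrix.sub_apply, Matrix.add_apply,
      Matrix.smul_apply, Fin.sum_univ_eight, Matrix.of_apply, Matrix.cons_val, smul_eq_mul,
      Fin.reduceFinMk, Fin.zero_eta, Fin.mk_one, Fin.isValue, Matrix.one_apply,
      Fin.reduceEq, reduceIte]
  all_goals ring

set_option maxHeartbeats 4000000 in
theorem repB_W {k : Type*} [Field k] (ζ u t : k) (hz : ζ ^ 4 = -1) :
    repBZ ζ u t * repBU ζ u t + ζ • (repBU ζ u t * repBZ ζ u t) = repBW ζ u t := by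
  ext i j
  fin_cases i <;> fin_cases j <;>
    simp only [repBW, repBU, repBZ, Matrix.mul_apply, Matrix.sub_apply, Matrix.add_apply,
      Matrix.smul_apply, Fin.sum_univ_eight, Matrix.of_apply, Matrix.cons_val, smul_eq_mul,
      Fin.reduceFinMk, Fin.zero_eta, Fin.mk_one, Fin.isValue, Matrix.one_apply,
      Fin.reduceEq, reduceIte]
  any_goals ring1
  · linear_combination (-t) * hz
  · linear_combination (-t) * hz

set_option maxHeartbeats 4000000 in
theorem repB_X {k : Type*} [Field k] (ζ u t : k) (hz : ζ ^ 4 = -1) :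
    repBZ ζ u t * repBW ζ u t + ζ ^ 2 • (repBW ζ u t * repBZ ζ u t) = repBX ζ u t := by
  ext i j
  fin_cases i <;> fin_cases j <;>
    simp only [repBX, repBW, repBZ, Matrix.mul_apply, Matrix.sub_apply, Matrix.add_apply,
      Matrix.smul_apply, Fin.sum_univ_eight, Matrix.of_apply, Matrix.cons_val, smul_eq_mul,
      Fin.reduceFinMk, Fin.zero_eta, Fin.mk_one, Fin.isValue, Matrix.one_apply,
      Fin.reduceEq, reduceIte]
  any_goals ring1
  · linear_combination (-ζ*t - ζ^2*t) * hz
  · linear_combination (-ζ*t) * hz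

set_option maxHeartbeats 4000000 in
theorem repB_T {k : Type*} [Field k] (ζ u t : k) (hz : ζ ^ 4 = -1) :
    repBW ζ u t * repBU ζ u t + ζ ^ 3 • (repBU ζ u t * repBW ζ u t) = repBT ζ u t := by
  ext i j
  fin_cases i <;> fin_cases j <;>
    simp only [repBT, repBW, repBU, Matrix.mul_apply, Matrix.sub_apply, Matrix.add_apply,
      Matrix.smul_apply, Fin.sum_univ_eight, Matrix.of_apply, Matrix.cons_val, smul_eq_mul,
      Fin.reduceFinMk, Fin.zero_eta, Fin.mk_one, Fin.isValue, Matrix.one_apply,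
      Fin.reduceEq, reduceIte]
  any_goals ring1
  · linear_combination (t - ζ^2*t) * hz
  · linear_combination (t - ζ^2*t - ζ^3*t) * hz
  · linear_combination (1) * hz
  · linear_combination (-ζ^2*t) * hz

set_option maxHeartbeats 4000000 in
theorem repB_rel1 {k : Type*} [Field k] (ζ u t : k) (hz : ζ ^ 4 = -1) :
    repBZ ζ u t * repBX ζ u t + ζ ^ 3 • (repBX ζ u t * repBZ ζ u t) =
      (0 : k) • (1 : Matrix (Fin 8) (Fin 8) k) := by
  ext i j
  fin_cases i <;> fin_cases j <;>
    simp only [repBX, repBZ, Matrix.mul_apply, Matrix.sub_apply, Matrix.add_apply,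
      Matrix.smul_apply, Fin.sum_univ_eight, Matrix.of_apply, Matrix.cons_val, smul_eq_mul,
      Fin.reduceFinMk, Fin.zero_eta, Fin.mk_one, Fin.isValue, Matrix.one_apply,
      Fin.reduceEq, reduceIte]
  all_goals ring

set_option maxHeartbeats 4000000 in
theorem repB_rel2 {k : Type*} [Field k] (ζ u t : k) (hz : ζ ^ 4 = -1) :
    repBY ζ u t * repBY ζ u t =
      (u) • (1 : Matrix (Fin 8) (Fin 8) k) := by
  ext i j
  fin_cases i <;> fin_cases j <;>
    simp only [repBY, Matrix.mul_apply, Matrix.sub_apply, Matrix.add_apply,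
      Matrix.smul_apply, Fin.sum_univ_eight, Matrix.of_apply, Matrix.cons_val, smul_eq_mul,
      Fin.reduceFinMk, Fin.zero_eta, Fin.mk_one, Fin.isValue, Matrix.one_apply,
      Fin.reduceEq, reduceIte]
  all_goals ring

set_option maxHeartbeats 4000000 in
theorem repB_rel3 {k : Type*} [Field k] (ζ u t : k) (hz : ζ ^ 4 = -1) :
    repBT ζ u t * repBU ζ u t - ζ • (repBU ζ u t * repBT ζ u t) =
      (t) • (1 : Matrix (Fin 8) (Fin 8) k) := by
  ext i j
  fin_cases i <;> fin_cases j <;>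
    simp only [repBT, repBU, Matrix.mul_apply, Matrix.sub_apply, Matrix.add_apply,
      Matrix.smul_apply, Fin.sum_univ_eight, Matrix.of_apply, Matrix.cons_val, smul_eq_mul,
      Fin.reduceFinMk, Fin.zero_eta, Fin.mk_one, Fin.isValue, Matrix.one_apply,
      Fin.reduceEq, reduceIte]
  any_goals ring1
  · linear_combination (-t) * hz
  · linear_combination (-t) * hz
  · linear_combination (-t) * hz
  · linear_combination (-t + ζ*t + ζ^3*t) * hz
  · linear_combination (-t - ζ^2*t) * hz

/-- If an algebra contains elements `Y₁`, `Y₂` satisfying the three deformed relations, then the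
ideal generated by these relations does not contain `1`. -/
theorem one_notMem_of_rep {k : Type*} [Field k] {M : Type*} [Ring M] [Nontrivial M] [Algebra k M]
    (ζ : k) (hz : ζ ^ 4 = -1) (lam₁ lam₂ lam₃ : k) (Y₁ Y₂ U W X T : M)
    (hU : Y₁ * Y₂ + Y₂ * Y₁ = U) (hW : Y₁ * U + ζ • (U * Y₁) = W)
    (hX : Y₁ * W + ζ ^ 2 • (W * Y₁) = X) (hT : W * U + ζ ^ 3 • (U * W) = T)
    (h₁ : Y₁ * X + ζ ^ 3 • (X * Y₁) = lam₁ • (1 : M))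
    (h₂ : Y₂ * Y₂ = lam₂ • (1 : M))
    (h₃ : T * U - ζ • (U * T) = lam₃ • (1 : M))
    (q : Fin 2 → Fin 2 → k) (hq : q = ![![ζ, -1], ![ζ, -1]]) :
    (1 : FreeAlgebra k (Fin 2)) ∉ TwoSidedIdeal.span
      ({(bc q (ygen k 0) (bc q (ygen k 0) (bc q (ygen k 0) (bc q (ygen k 0) (ygen k 1))))).1 - algebraMap k (FreeAlgebra k (Fin 2)) lam₁,
        FreeAlgebra.ι k (1 : Fin 2) ^ 2 - algebraMap k (FreeAlgebra k (Fin 2)) lam₂,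
        (bc q (bc q (bc q (ygen k 0) (bc q (ygen k 0) (ygen k 1))) (bc q (ygen k 0) (ygen k 1))) (bc q (ygen k 0) (ygen k 1))).1 - algebraMap k (FreeAlgebra k (Fin 2)) lam₃} : Set (FreeAlgebra k (Fin 2))) := by
  intro hmem
  let φ : FreeAlgebra k (Fin 2) →ₐ[k] M := FreeAlgebra.lift k ![Y₁, Y₂]
  have p0 : φ (ygen k 0).1 = Y₁ := by simp [φ, ygen]
  have p1 : φ (ygen k 1).1 = Y₂ := by simp [φ, ygen]
  have p1' : φ (FreeAlgebra.ι k (1 : Fin 2)) = Y₂ := by simp [φ]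
  have key : ∀ a b : FreeAlgebra k (Fin 2) × (Fin 2 → ℕ),
      φ (bc q a b).1 = φ a.1 * φ b.1 - qForm q a.2 b.2 • (φ b.1 * φ a.1) := by
    intro a b
    simp [bc]
  have kU : φ (bc q (ygen k 0) (ygen k 1)).1 = U := by
    rw [key, p0, p1, ← hU]
    have : qForm q (ygen k 0).2 (ygen k 1).2 = -1 := by
      subst hq; simp [qForm, ygen, Fin.prod_univ_two]
    rw [this]; simp
  have kW : φ (bc q (ygen k 0) (bc q (ygen k 0) (ygen k 1))).1 = W := by
    rw [key, p0, kU, ← hW]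
    have : qForm q (ygen k 0).2 (bc q (ygen k 0) (ygen k 1)).2 = -ζ := by
      subst hq; simp [qForm, ygen, bc, Fin.prod_univ_two]
    rw [this]; simp
  have kX : φ (bc q (ygen k 0) (bc q (ygen k 0) (bc q (ygen k 0) (ygen k 1)))).1 = X := by
    rw [key, p0, kW, ← hX]
    have : qForm q (ygen k 0).2 (bc q (ygen k 0) (bc q (ygen k 0) (ygen k 1))).2 = -ζ ^ 2 := by
      subst hq; simp [qForm, ygen, bc, Fin.prod_univ_two]
    rw [this]; simp
  have kT : φ (bc q (bc q (ygen k 0) (bc q (ygen k 0) (ygen k 1)))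
      (bc q (ygen k 0) (ygen k 1))).1 = T := by
    rw [key, kW, kU, ← hT]
    have : qForm q (bc q (ygen k 0) (bc q (ygen k 0) (ygen k 1))).2
        (bc q (ygen k 0) (ygen k 1)).2 = -ζ ^ 3 := by
      subst hq; simp [qForm, ygen, bc, Fin.prod_univ_two]; try ring
    rw [this]; simp
  have hle : TwoSidedIdeal.span
      ({(bc q (ygen k 0) (bc q (ygen k 0) (bc q (ygen k 0) (bc q (ygen k 0) (ygen k 1))))).1 - algebraMap k (FreeAlgebra k (Fin 2)) lam₁,
        FreeAlgebra.ι k (1 : Fin 2) ^ 2 - algebraMap k (FreeAlgebra k (Fin 2)) lam₂,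
        (bc q (bc q (bc q (ygen k 0) (bc q (ygen k 0) (ygen k 1))) (bc q (ygen k 0) (ygen k 1))) (bc q (ygen k 0) (ygen k 1))).1 - algebraMap k (FreeAlgebra k (Fin 2)) lam₃} : Set (FreeAlgebra k (Fin 2)))
      ≤ TwoSidedIdeal.ker φ := by
    rw [TwoSidedIdeal.span_le]
    rintro a (rfl | rfl | rfl)
    · rw [SetLike.mem_coe, TwoSidedIdeal.mem_ker, map_sub, AlgHom.commutes,
        Algebra.algebraMap_eq_smul_one, key, p0, kX, ← h₁]
      have : qForm q (ygen k 0).2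
          (bc q (ygen k 0) (bc q (ygen k 0) (bc q (ygen k 0) (ygen k 1)))).2 = -ζ ^ 3 := by
        subst hq; simp [qForm, ygen, bc, Fin.prod_univ_two]
      rw [this]; simp
    · rw [SetLike.mem_coe, TwoSidedIdeal.mem_ker, map_sub, AlgHom.commutes,
        Algebra.algebraMap_eq_smul_one, map_pow, p1', pow_two, h₂, sub_self]
    · rw [SetLike.mem_coe, TwoSidedIdeal.mem_ker, map_sub, AlgHom.commutes,
        Algebra.algebraMap_eq_smul_one, key, kT, kU, ← h₃]
      have : qForm q (bc q (bc q (ygen k 0) (bc q (ygen k 0) (ygen k 1)))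
          (bc q (ygen k 0) (ygen k 1))).2 (bc q (ygen k 0) (ygen k 1)).2 = ζ := by
        subst hq
        simp [qForm, ygen, bc, Fin.prod_univ_two]
        linear_combination (-ζ) * hz
      rw [this]; simp
  have h1 : φ 1 = 0 := (TwoSidedIdeal.mem_ker φ).1 (hle hmem)
  rw [map_one] at h1
  exact one_ne_zero h1

/-- A solution may be rescaled: `Y₁ ↦ x Y₁`, `Y₂ ↦ d Y₂`. -/
theorem one_notMem_of_scaled {k : Type*} [Field k] {M : Type*} [Ring M] [Nontrivial M]
    [Algebra k M] (ζ : k) (hz : ζ ^ 4 = -1) (a₁ a₂ a₃ x d lam₁ lam₂ lam₃ : k)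
    (Z Y U W X T : M)
    (hU : Z * Y + Y * Z = U) (hW : Z * U + ζ • (U * Z) = W)
    (hX : Z * W + ζ ^ 2 • (W * Z) = X) (hT : W * U + ζ ^ 3 • (U * W) = T)
    (h₁ : Z * X + ζ ^ 3 • (X * Z) = a₁ • (1 : M))
    (h₂ : Y * Y = a₂ • (1 : M))
    (h₃ : T * U - ζ • (U * T) = a₃ • (1 : M))
    (e₁ : lam₁ = x ^ 4 * d * a₁) (e₂ : lam₂ = d ^ 2 * a₂) (e₃ : lam₃ = x ^ 4 * d ^ 3 * a₃)
    (q : Fin 2 → Fin 2 → k) (hq : q = ![![ζ, -1], ![ζ, -1]]) :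
    (1 : FreeAlgebra k (Fin 2)) ∉ TwoSidedIdeal.span
      ({(bc q (ygen k 0) (bc q (ygen k 0) (bc q (ygen k 0) (bc q (ygen k 0) (ygen k 1))))).1 - algebraMap k (FreeAlgebra k (Fin 2)) lam₁,
        FreeAlgebra.ι k (1 : Fin 2) ^ 2 - algebraMap k (FreeAlgebra k (Fin 2)) lam₂,
        (bc q (bc q (bc q (ygen k 0) (bc q (ygen k 0) (ygen k 1))) (bc q (ygen k 0) (ygen k 1))) (bc q (ygen k 0) (ygen k 1))).1 - algebraMap k (FreeAlgebra k (Fin 2)) lam₃} : Set (FreeAlgebra k (Fin 2))) := by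
  refine one_notMem_of_rep ζ hz lam₁ lam₂ lam₃ (x • Z) (d • Y) ((x * d) • U) ((x ^ 2 * d) • W)
    ((x ^ 3 * d) • X) ((x ^ 3 * d ^ 2) • T) ?_ ?_ ?_ ?_ ?_ ?_ ?_ q hq
  · rw [← hU]; simp only [smul_mul_smul_comm]; module
  · rw [← hW]; simp only [smul_mul_smul_comm]; module
  · rw [← hX]; simp only [smul_mul_smul_comm]; module
  · rw [← hT]; simp only [smul_mul_smul_comm]; module
  · rw [e₁, mul_smul _ a₁, ← h₁]; simp only [smul_mul_smul_comm]; module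
  · rw [e₂, mul_smul _ a₂, ← h₂]; simp only [smul_mul_smul_comm]; module
  · rw [e₃, mul_smul _ a₃, ← h₃]; simp only [smul_mul_smul_comm]; module

/-- The choice of parameters for the first family when `lam₁ ≠ 0`. -/
theorem exists_params {k : Type*} [Field k] [IsAlgClosed k] [CharZero k]
    (ζ : k) (hz : ζ ^ 4 = -1) (lam₁ lam₂ lam₃ : k) (hl : lam₁ ≠ 0) :
    ∃ x d u t : k, lam₁ = x ^ 4 * d * (4 * ζ ^ 3) ∧
      lam₂ = d ^ 2 * (1 + 4 * (1 + (ζ ^ 3 - ζ)) * t +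
        4 * (1 + (ζ ^ 3 - ζ)) ^ 2 * (u * (2 - (ζ ^ 3 - ζ) - u)) * t) ∧
      lam₃ = x ^ 4 * d ^ 3 *
        (8 * (2 + (ζ ^ 3 - ζ)) * (1 + ζ) * (1 + 2 * (1 + (ζ ^ 3 - ζ)) ^ 2 * t)) := by
  have hζ0 : ζ ≠ 0 := by
    rintro rfl
    norm_num at hz
  have hζ1 : 1 + ζ ≠ 0 := by
    intro h
    have : ζ = -1 := by linear_combination h
    rw [this] at hz
    norm_num at hz
  obtain ⟨r, hr⟩ : ∃ r, r = ζ ^ 3 - ζ := ⟨_, rfl⟩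
  have hr2 : r ^ 2 = 2 := by
    rw [hr]; linear_combination (ζ ^ 2 - 2) * hz
  rw [← hr]
  have hr1 : 1 + r ≠ 0 := by
    intro h
    have : (1 : k) = 0 := by linear_combination (r - 1) * h - hr2
    exact one_ne_zero this
  have hr3 : 2 + r ≠ 0 := by
    intro h
    have : (2 : k) = 0 := by linear_combination (2 - r) * h + hr2
    exact two_ne_zero this
  obtain ⟨K, hK⟩ : ∃ K, K = lam₃ * (4 * ζ ^ 3) / (lam₁ * (8 * (2 + r) * (1 + ζ))) /
    (2 * (1 + r) ^ 2) := ⟨_, rfl⟩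
  -- a nonzero value of the parameter `t` can be reached
  obtain ⟨d, hd, ht⟩ : ∃ d : k, d ≠ 0 ∧ K / d ^ 2 - 1 / (2 * (1 + r) ^ 2) ≠ 0 := by
    by_cases h : K / 1 ^ 2 - 1 / (2 * (1 + r) ^ 2) = 0
    · refine ⟨2, two_ne_zero, fun h' => ?_⟩
      have h0 : 1 / (2 * (1 + r) ^ 2) ≠ 0 := one_div_ne_zero (mul_ne_zero two_ne_zero (pow_ne_zero 2 hr1))
      apply h0
      linear_combination (1 / 3) * h - (4 / 3) * h'
    · exact ⟨1, one_ne_zero, h⟩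
  obtain ⟨t, htd⟩ : ∃ t, t = K / d ^ 2 - 1 / (2 * (1 + r) ^ 2) := ⟨_, rfl⟩
  rw [← htd] at ht
  obtain ⟨x, hx⟩ := IsAlgClosed.exists_pow_nat_eq (lam₁ / (4 * ζ ^ 3 * d)) (n := 4) (by norm_num)
  obtain ⟨s, hs⟩ : ∃ s, s = (lam₂ / d ^ 2 - 1 - 4 * (1 + r) * t) / (4 * (1 + r) ^ 2 * t) :=
    ⟨_, rfl⟩
  obtain ⟨y, hy⟩ := IsAlgClosed.exists_pow_nat_eq (((2 - r) / 2) ^ 2 - s) (n := 2) (by norm_num)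
  have hu : ((2 - r) / 2 + y) * (2 - r - ((2 - r) / 2 + y)) = s := by
    linear_combination -hy
  refine ⟨x, d, (2 - r) / 2 + y, t, ?_, ?_, ?_⟩
  · rw [hx]; field_simp
  · rw [hu, hs]; field_simp; ring
  · rw [hx, htd, hK]; field_simp; ring

theorem statement_5 {k : Type*} [Field k] [IsAlgClosed k] [CharZero k]
    (ζ : k) (hζ : IsPrimitiveRoot ζ 8)
    (lam₁ lam₂ lam₃ : k)
    (q : Fin 2 → Fin 2 → k) (hq : q = ![![ζ, -1], ![ζ, -1]]) :
    (1 : FreeAlgebra k (Fin 2)) ∉ TwoSidedIdeal.span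
      ({(bc q (ygen k 0) (bc q (ygen k 0) (bc q (ygen k 0) (bc q (ygen k 0) (ygen k 1))))).1 - algebraMap k (FreeAlgebra k (Fin 2)) lam₁,
        FreeAlgebra.ι k (1 : Fin 2) ^ 2 - algebraMap k (FreeAlgebra k (Fin 2)) lam₂,
        (bc q (bc q (bc q (ygen k 0) (bc q (ygen k 0) (ygen k 1))) (bc q (ygen k 0) (ygen k 1))) (bc q (ygen k 0) (ygen k 1))).1 - algebraMap k (FreeAlgebra k (Fin 2)) lam₃} : Set (FreeAlgebra k (Fin 2))) := by
  have hz : ζ ^ 4 = -1 := by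
    have h8 : ζ ^ 8 = 1 := hζ.pow_eq_one
    have h4 : ζ ^ 4 ≠ 1 := hζ.pow_ne_one_of_pos_of_lt (by norm_num) (by norm_num)
    have h : (ζ ^ 4 - 1) * (ζ ^ 4 + 1) = 0 := by linear_combination h8
    rcases mul_eq_zero.1 h with h | h
    · exact absurd (sub_eq_zero.1 h) h4
    · exact eq_neg_of_add_eq_zero_left h
  by_cases hl : lam₁ = 0
  · exact one_notMem_of_rep ζ hz lam₁ lam₂ lam₃ _ _ _ _ _ _
      (repB_U ζ lam₂ lam₃ hz) (repB_W ζ lam₂ lam₃ hz) (repB_X ζ lam₂ lam₃ hz)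
      (repB_T ζ lam₂ lam₃ hz) (by rw [hl]; exact repB_rel1 ζ lam₂ lam₃ hz)
      (repB_rel2 ζ lam₂ lam₃ hz) (repB_rel3 ζ lam₂ lam₃ hz) q hq
  · obtain ⟨x, d, u, t, e₁, e₂, e₃⟩ := exists_params ζ hz lam₁ lam₂ lam₃ hl
    exact one_notMem_of_scaled ζ hz _ _ _ x d lam₁ lam₂ lam₃ _ _ _ _ _ _
      (repA_U ζ u t hz) (repA_W ζ u t hz) (repA_X ζ u t hz) (repA_T ζ u t hz)
      (repA_rel1 ζ u t hz) (repA_rel2 ζ u t hz) (repA_rel3 ζ u t hz) e₁ e₂ e₃ q hq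
end

section
/- Let k be an algebraically closed field of characteristic 0 and ζ ∈ k a primitive 5th root of unity. Let the 2×2 braiding matrix be q_{11} = ζ, q_{12} = 1, q_{21} = ζ², q_{22} = −1 (super modular type brj(2;5)). Then for every λ₁, λ₂ ∈ k, the quotient of the free algebra k⟨y_1,y_2⟩ by the two-sided ideal generated by y_{11112}, [[[y_{112}, y_{12}]_c, y_{12}]_c, y_{12}]_c, [y_{1112}, y_{112}]_c − λ₁, and y_2² − λ₂ is a nontrivial algebra. -/
/-- entry polynomial -/
def fu {k : Type*} [Field k] (ζ y : k) : k :=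
  1 + ζ^2 + ζ^3 - y^1 + y^2 + ζ^2*y^2 + ζ^3*y^2

/-- entry polynomial -/
def fv {k : Type*} [Field k] (ζ y : k) : k :=
  - 1 - ζ^2 - ζ^3 - y^1 + y^2 + y^3 + ζ^2*y^3 + ζ^3*y^3

/-- entry polynomial -/
def fu1 {k : Type*} [Field k] (ζ y : k) : k :=
  y^1 - ζ^1*y^1 - y^2 - ζ^1*y^2 - ζ^2*y^2 - 2*ζ^3*y^2

/-- entry polynomial -/
def fv1 {k : Type*} [Field k] (ζ y : k) : k :=
  y^1 - ζ^1*y^1 - y^2 + ζ^2*y^2 + ζ^1*y^3 - ζ^2*y^3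

/-- entry polynomial -/
def fu2 {k : Type*} [Field k] (ζ y : k) : k :=
  - 3*y^2 - ζ^2*y^2 - ζ^3*y^2

/-- entry polynomial -/
def fv2 {k : Type*} [Field k] (ζ y : k) : k :=
  - y^2 - 2*ζ^2*y^2 - 2*ζ^3*y^2 - 2*y^3 - ζ^1*y^3 - 2*ζ^2*y^3

/-- entry polynomial -/
def fv3 {k : Type*} [Field k] (ζ y : k) : k :=
  - 3*y^3 - ζ^1*y^3 + ζ^2*y^3 - 2*ζ^3*y^3

/-- entry polynomial -/
def fa1 {k : Type*} [Field k] (ζ y : k) : k :=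
  3 + ζ^1 - ζ^2 + 2*ζ^3 + 3*y^3 + ζ^1*y^3 - ζ^2*y^3 + 2*ζ^3*y^3 - y^4 - 2*ζ^1*y^4 - 3*ζ^2*y^4 - 4*ζ^3*y^4

/-- entry polynomial -/
def fa2 {k : Type*} [Field k] (ζ y : k) : k :=
  - 2 + ζ^1 - ζ^2 + 2*ζ^3 + 3*y^3 + ζ^1*y^3 + 4*ζ^2*y^3 + 2*ζ^3*y^3 - y^4 - 2*ζ^1*y^4 - 3*ζ^2*y^4 - 4*ζ^3*y^4

/-- entry polynomial -/
def fb1 {k : Type*} [Field k] (ζ y : k) : k :=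
  5 + 5*ζ^1 + 5*ζ^2 + 10*ζ^3 - 5*y^1 + 5*ζ^1*y^1 + 5*y^2 + 10*ζ^1*y^2 + 10*ζ^3*y^2 - 5*y^4 + 5*ζ^1*y^4 - 5*ζ^2*y^4 + 5*ζ^3*y^4

/-- entry polynomial -/
def fb2 {k : Type*} [Field k] (ζ y : k) : k :=
  0

lemma e_uv {k : Type*} [Field k] (ζ y : k) (hz : 1 + ζ + ζ^2 + ζ^3 + ζ^4 = 0) (hy : y^5 = 1) :
    fu ζ y * fv ζ y = 0 := by
  unfold fu fv
  linear_combination (1 + 2*ζ^2 + 2*ζ^3 + ζ^4 + 2*ζ^5 + ζ^6) * hy + (y^2 - ζ^1*y^2 - ζ^2*y^2 - y^3 + ζ^1*y^3 + ζ^2*y^3) * hz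

lemma e_vu {k : Type*} [Field k] (ζ y : k) (hz : 1 + ζ + ζ^2 + ζ^3 + ζ^4 = 0) (hy : y^5 = 1) :
    fv ζ y * fu ζ y = 0 := by
  unfold fu fv
  linear_combination (1 + 2*ζ^2 + 2*ζ^3 + ζ^4 + 2*ζ^5 + ζ^6) * hy + (y^2 - ζ^1*y^2 - ζ^2*y^2 - y^3 + ζ^1*y^3 + ζ^2*y^3) * hz

lemma e_u1 {k : Type*} [Field k] (ζ y : k) (hz : 1 + ζ + ζ^2 + ζ^3 + ζ^4 = 0) (hy : y^5 = 1) :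
    fu ζ (ζ^1*y) + (-1) * fu ζ y = fu1 ζ y := by
  unfold fu fu1
  linear_combination (ζ^1*y^2) * hz

lemma e_v1 {k : Type*} [Field k] (ζ y : k) (hz : 1 + ζ + ζ^2 + ζ^3 + ζ^4 = 0) (hy : y^5 = 1) :
    fv ζ (ζ^1*y) + (-1) * fv ζ y = fv1 ζ y := by
  unfold fv fv1
  linear_combination (- y^3 + ζ^2*y^3) * hz

lemma e_u2 {k : Type*} [Field k] (ζ y : k) (hz : 1 + ζ + ζ^2 + ζ^3 + ζ^4 = 0) (hy : y^5 = 1) :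
    fu1 ζ (ζ^1*y) + (-ζ) * fu1 ζ y = fu2 ζ y := by
  unfold fu1 fu2
  linear_combination (3*y^2 - 2*ζ^1*y^2) * hz

lemma e_v2 {k : Type*} [Field k] (ζ y : k) (hz : 1 + ζ + ζ^2 + ζ^3 + ζ^4 = 0) (hy : y^5 = 1) :
    fv1 ζ (ζ^1*y) + (-ζ) * fv1 ζ y = fv2 ζ y := by
  unfold fv1 fv2
  linear_combination (y^2 + 2*y^3 - ζ^1*y^3) * hz

lemma e_u3 {k : Type*} [Field k] (ζ y : k) (hz : 1 + ζ + ζ^2 + ζ^3 + ζ^4 = 0) (hy : y^5 = 1) :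
    fu2 ζ (ζ^1*y) + (-ζ^2) * fu2 ζ y = 0 := by
  unfold fu2
  linear_combination (0) * hz

lemma e_v3 {k : Type*} [Field k] (ζ y : k) (hz : 1 + ζ + ζ^2 + ζ^3 + ζ^4 = 0) (hy : y^5 = 1) :
    fv2 ζ (ζ^1*y) + (-ζ^2) * fv2 ζ y = fv3 ζ y := by
  unfold fv2 fv3
  linear_combination (3*y^3 - 2*ζ^1*y^3) * hz

lemma e_v4 {k : Type*} [Field k] (ζ y : k) (hz : 1 + ζ + ζ^2 + ζ^3 + ζ^4 = 0) (hy : y^5 = 1) :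
    fv3 ζ (ζ^1*y) + (-ζ^3) * fv3 ζ y = 0 := by
  unfold fv3
  linear_combination (0) * hz

lemma e_L1 {k : Type*} [Field k] (ζ y : k) (hz : 1 + ζ + ζ^2 + ζ^3 + ζ^4 = 0) (hy : y^5 = 1) :
    fu2 ζ y * fv3 ζ (ζ^2*y) = -(10+5*ζ^2+10*ζ^3) := by
  unfold fu2 fv3
  linear_combination (9*ζ^6 + 3*ζ^7 + 10*ζ^9 + ζ^11 + 2*ζ^12) * hy + (10 - 10*ζ^1 + 5*ζ^2 + 5*ζ^3 - 10*ζ^4 + 10*ζ^5 - ζ^6 - ζ^7 + 2*ζ^8) * hz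

lemma e_L2 {k : Type*} [Field k] (ζ y : k) (hz : 1 + ζ + ζ^2 + ζ^3 + ζ^4 = 0) (hy : y^5 = 1) :
    fv3 ζ y * fu2 ζ (ζ^3*y) = -(10+5*ζ^2+10*ζ^3) := by
  unfold fu2 fv3
  linear_combination (9*ζ^6 + 3*ζ^7 + 10*ζ^9 + ζ^11 + 2*ζ^12) * hy + (10 - 10*ζ^1 + 5*ζ^2 + 5*ζ^3 - 10*ζ^4 + 10*ζ^5 - ζ^6 - ζ^7 + 2*ζ^8) * hz

lemma e_a1 {k : Type*} [Field k] (ζ y : k) (hz : 1 + ζ + ζ^2 + ζ^3 + ζ^4 = 0) (hy : y^5 = 1) :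
    fu2 ζ y * fv1 ζ (ζ^2*y) + ζ^4 * fu1 ζ y * fv2 ζ (ζ^1*y) = fa1 ζ y := by
  unfold fa1 fu1 fu2 fv1 fv2
  linear_combination (- ζ^7 + 6*ζ^8 + 4*ζ^9 + 7*ζ^10 + 5*ζ^11 + 4*ζ^12) * hy + (- 3 + 2*ζ^1 + 2*ζ^2 - 3*ζ^3 + 2*ζ^4 - 3*ζ^5 + 2*ζ^6 + ζ^7 + 4*ζ^8 - 3*y^3 + 2*ζ^1*y^3 - ζ^2*y^3 + 3*ζ^3*y^3 - 2*ζ^4*y^3 - 2*ζ^5*y^3 + 2*ζ^6*y^3 + y^4 + ζ^1*y^4 + ζ^2*y^4 + ζ^3*y^4 - ζ^4*y^4 - 2*ζ^5*y^4 + 2*ζ^7*y^4 + 4*ζ^8*y^4) * hz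

lemma e_a2 {k : Type*} [Field k] (ζ y : k) (hz : 1 + ζ + ζ^2 + ζ^3 + ζ^4 = 0) (hy : y^5 = 1) :
    fv2 ζ y * fu1 ζ (ζ^2*y) + ζ^4 * fv1 ζ y * fu2 ζ (ζ^1*y) = fa2 ζ y := by
  unfold fa2 fu1 fu2 fv1 fv2
  linear_combination (2*ζ^4 + 3*ζ^5 + 5*ζ^6 + 4*ζ^7 + 7*ζ^8 + 3*ζ^9 + ζ^11) * hy + (2 - 3*ζ^1 + 2*ζ^2 - 3*ζ^3 + 4*ζ^4 + 3*ζ^5 - ζ^6 + ζ^7 - 3*y^3 + 2*ζ^1*y^3 - 4*ζ^2*y^3 + 4*ζ^3*y^3 - ζ^4*y^3 - ζ^5*y^3 + ζ^6*y^3 + y^4 + ζ^1*y^4 - ζ^2*y^4 + 4*ζ^3*y^4 - 5*ζ^4*y^4 + 4*ζ^5*y^4 + 4*ζ^6*y^4 - ζ^7*y^4) * hz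

lemma e_b1 {k : Type*} [Field k] (ζ y : k) (hz : 1 + ζ + ζ^2 + ζ^3 + ζ^4 = 0) (hy : y^5 = 1) :
    fa1 ζ y * fu1 ζ (ζ^3*y) + (-ζ^2) * fu1 ζ y * fa2 ζ (ζ^1*y) = fb1 ζ y := by
  unfold fa1 fa2 fb1 fu1
  linear_combination (- ζ^3 - ζ^4 + 2*ζ^5 + ζ^6 + 9*ζ^7 + 11*ζ^8 + ζ^9 + 3*ζ^10 + 4*ζ^11 - 4*ζ^12) * hy + (- 5 - 6*ζ^3 + 10*ζ^4 - 2*ζ^5 - ζ^6 + 8*ζ^7 - 4*ζ^8 + 5*y^1 - 10*ζ^1*y^1 + 7*ζ^2*y^1 - 2*ζ^3*y^1 - 5*y^2 - 5*ζ^1*y^2 + 8*ζ^2*y^2 - 9*ζ^3*y^2 + 9*ζ^4*y^2 - 5*ζ^5*y^2 - 3*ζ^6*y^2 + 4*ζ^7*y^2 - 4*ζ^8*y^2 + 5*y^4 - 10*ζ^1*y^4 + 10*ζ^2*y^4 - 7*ζ^3*y^4 + 2*ζ^5*y^4) * hz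

lemma e_b2 {k : Type*} [Field k] (ζ y : k) (hz : 1 + ζ + ζ^2 + ζ^3 + ζ^4 = 0) (hy : y^5 = 1) :
    fa2 ζ y * fv1 ζ (ζ^3*y) + (-ζ^2) * fv1 ζ y * fa1 ζ (ζ^1*y) = fb2 ζ y := by
  unfold fa1 fa2 fb2 fv1
  linear_combination (- ζ^3 - ζ^4 + 2*ζ^5 - 2*ζ^6 + ζ^8 + ζ^9 - 2*ζ^10 + 2*ζ^11 - 3*ζ^6*y^1 + 2*ζ^7*y^1 + 2*ζ^8*y^1 - 3*ζ^9*y^1 + 5*ζ^10*y^1 - 2*ζ^11*y^1 + 3*ζ^12*y^1 - 2*ζ^13*y^1 - 2*ζ^14*y^1 + ζ^7*y^2 + ζ^8*y^2 + ζ^9*y^2 - 5*ζ^11*y^2 - ζ^12*y^2 - ζ^13*y^2 + 4*ζ^14*y^2) * hy + (- ζ^3 + 3*ζ^5 - 4*ζ^6 + 2*ζ^7 - 3*ζ^2*y^1 + 3*ζ^3*y^1 + 5*ζ^4*y^1 - 10*ζ^5*y^1 + 7*ζ^6*y^1 - 5*ζ^7*y^1 + 5*ζ^8*y^1 - 2*ζ^10*y^1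 + 3*ζ^2*y^2 - 2*ζ^3*y^2 - 5*ζ^4*y^2 + 5*ζ^5*y^2 + 2*ζ^6*y^2 - 2*ζ^7*y^2 - 5*ζ^9*y^2 + 4*ζ^10*y^2 - 3*ζ^3*y^3 + 5*ζ^4*y^3 - 5*ζ^6*y^3 + 5*ζ^7*y^3 - 5*ζ^8*y^3 + 5*ζ^9*y^3 - 2*ζ^10*y^3 + 3*ζ^3*y^4 - 5*ζ^4*y^4 + 2*ζ^5*y^4) * hz

lemma e_q1 {k : Type*} [Field k] (ζ y : k) (hz : 1 + ζ + ζ^2 + ζ^3 + ζ^4 = 0) (hy : y^5 = 1) :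
    fb1 ζ y * fv1 ζ (ζ^4*y) + fu1 ζ y * fb2 ζ (ζ^1*y) = 0 := by
  unfold fb1 fb2 fu1 fv1
  linear_combination (- 5*ζ^4 + 10*ζ^5 - 10*ζ^6 + 10*ζ^7 - 5*ζ^8 + 5*ζ^13 + 5*ζ^14 - 10*ζ^15 + 10*ζ^16 - 10*ζ^17 + 5*ζ^8*y^1 - 5*ζ^9*y^1 - 5*ζ^12*y^1 + 5*ζ^13*y^1 - 5*ζ^13*y^2 + 10*ζ^14*y^2 - 10*ζ^15*y^2 + 10*ζ^16*y^2 - 5*ζ^17*y^2) * hy + (- 5*ζ^4 + 15*ζ^5 - 20*ζ^6 + 20*ζ^7 - 15*ζ^8 + 15*ζ^10 - 20*ζ^11 + 20*ζ^12 - 10*ζ^13 + 5*ζ^4*y^1 - 5*ζ^5*y^1 + 5*ζ^7*y^1 - 10*ζ^8*y^1 + 5*ζ^9*y^1 - 5*ζ^4*y^2 + 15*ζ^5*y^2 - 15*ζ^6*y^2 + 5*ζ^7*y^2 - 5*ζ^8*y^2 - 5*ζ^9*y^2 + 20*ζ^10*y^2 - 20*ζ^11*y^2 + 15*ζ^12*y^2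 - 5*ζ^13*y^2 + 5*ζ^4*y^3 - 15*ζ^6*y^3 + 20*ζ^7*y^3 - 15*ζ^8*y^3 + 5*ζ^9*y^3 - 5*ζ^11*y^3 + 15*ζ^12*y^3 - 10*ζ^13*y^3 - 5*ζ^8*y^4 - 5*ζ^9*y^4 + 15*ζ^10*y^4 - 5*ζ^11*y^4) * hz

lemma e_q2 {k : Type*} [Field k] (ζ y : k) (hz : 1 + ζ + ζ^2 + ζ^3 + ζ^4 = 0) (hy : y^5 = 1) :
    fb2 ζ y * fu1 ζ (ζ^4*y) + fv1 ζ y * fb1 ζ (ζ^1*y) = 0 := by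
  unfold fb1 fb2 fu1 fv1
  linear_combination (5*ζ^3 - 5*ζ^8 + 5*ζ^4*y^1 - 5*ζ^5*y^1 - 5*ζ^8*y^1 + 5*ζ^9*y^1 - 5*ζ^5*y^2 + 10*ζ^6*y^2 - 10*ζ^7*y^2 + 10*ζ^8*y^2 - 5*ζ^9*y^2) * hy + (5*ζ^3 - 5*ζ^4 + 5*y^1 - 5*ζ^1*y^1 + 5*ζ^3*y^1 - 10*ζ^4*y^1 + 5*ζ^5*y^1 - 5*y^2 - 5*ζ^1*y^2 + 20*ζ^2*y^2 - 20*ζ^3*y^2 + 15*ζ^4*y^2 - 5*ζ^5*y^2 + 10*ζ^1*y^3 - 10*ζ^2*y^3 - 10*ζ^2*y^4 + 10*ζ^3*y^4) * hz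

/-- The index set: fifth roots of unity in `k`. -/
abbrev Mu5 (k : Type*) [Field k] : Type _ := {y : k // y ^ 5 = 1}

/-- The shift `y ↦ ζ^n y` on the fifth roots of unity. -/
def shiftMu {k : Type*} [Field k] {ζ : k} (h5 : ζ ^ 5 = 1) (n : ℕ) (y : Mu5 k) : Mu5 k :=
  ⟨ζ ^ n * y.1, by rw [mul_pow, ← pow_mul, mul_comm n 5, pow_mul, h5, one_pow, one_mul, y.2]⟩

/-- The operator `f ↦ (y ↦ M(y) f(ζ^n y))` on vector valued functions on `Mu5`. -/
def op {k : Type*} [Field k] {ζ : k} (h5 : ζ ^ 5 = 1) (n : ℕ)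
    (M : k → Matrix (Fin 2) (Fin 2) k) : Module.End k (Mu5 k → Fin 2 → k) where
  toFun f := fun y => (M y.1).mulVec (f (shiftMu h5 n y))
  map_add' f g := by
    funext y
    simp [Matrix.mulVec_add]
  map_smul' a f := by
    funext y
    simp [Matrix.mulVec_smul]

lemma op_mul {k : Type*} [Field k] {ζ : k} (h5 : ζ ^ 5 = 1) (n m : ℕ)
    (M N : k → Matrix (Fin 2) (Fin 2) k) :
    op h5 n M * op h5 m N = op h5 (n + m) (fun y => M y * N (ζ ^ n * y)) := by
  apply LinearMap.ext
  intro f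
  funext y
  have hs : shiftMu h5 m (shiftMu h5 n y) = shiftMu h5 (n + m) y := by
    apply Subtype.ext
    simp only [shiftMu]
    ring
  change (M y.1).mulVec ((N (ζ ^ n * y.1)).mulVec (f (shiftMu h5 m (shiftMu h5 n y)))) =
    (M y.1 * N (ζ ^ n * y.1)).mulVec (f (shiftMu h5 (n + m) y))
  rw [hs, Matrix.mulVec_mulVec]

lemma op_sub_smul {k : Type*} [Field k] {ζ : k} (h5 : ζ ^ 5 = 1) (n : ℕ) (t : k)
    (M N P : k → Matrix (Fin 2) (Fin 2) k)
    (h : ∀ y : k, y ^ 5 = 1 → M y - t • N y = P y) :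
    op h5 n M - t • op h5 n N = op h5 n P := by
  apply LinearMap.ext
  intro f
  funext y
  change (M y.1).mulVec (f (shiftMu h5 n y)) - t • (N y.1).mulVec (f (shiftMu h5 n y)) =
    (P y.1).mulVec (f (shiftMu h5 n y))
  rw [← h y.1 y.2, Matrix.sub_mulVec, Matrix.smul_mulVec]

lemma op_scalar {k : Type*} [Field k] {ζ : k} (h5 : ζ ^ 5 = 1) (n : ℕ) (hn : ζ ^ n = 1) (t : k)
    (M : k → Matrix (Fin 2) (Fin 2) k)
    (h : ∀ y : k, y ^ 5 = 1 → M y = t • (1 : Matrix (Fin 2) (Fin 2) k)) :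
    op h5 n M = algebraMap k (Module.End k (Mu5 k → Fin 2 → k)) t := by
  apply LinearMap.ext
  intro f
  funext y
  have hs : shiftMu h5 n y = y := by
    apply Subtype.ext
    simp [shiftMu, hn]
  change (M y.1).mulVec (f (shiftMu h5 n y)) = t • f y
  rw [h y.1 y.2, hs, Matrix.smul_mulVec, Matrix.one_mulVec]

lemma op_zero {k : Type*} [Field k] {ζ : k} (h5 : ζ ^ 5 = 1) (n : ℕ) :
    op h5 n (fun _ => (0 : Matrix (Fin 2) (Fin 2) k)) = 0 := by
  apply LinearMap.ext
  intro f
  funext y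
  simp [op]

lemma bc_rep {k : Type*} [Field k] {ζ : k} (h5 : ζ ^ 5 = 1)
    (φ : FreeAlgebra k (Fin 2) →ₐ[k] Module.End k (Mu5 k → Fin 2 → k))
    (q : Fin 2 → Fin 2 → k) {u v : FreeAlgebra k (Fin 2) × (Fin 2 → ℕ)} {n m : ℕ}
    {M N : k → Matrix (Fin 2) (Fin 2) k} (hu : φ u.1 = op h5 n M) (hv : φ v.1 = op h5 m N)
    (t : k) (ht : qForm q u.2 v.2 = t) (P : k → Matrix (Fin 2) (Fin 2) k)
    (h : ∀ y : k, y ^ 5 = 1 → M y * N (ζ ^ n * y) - t • (N y * M (ζ ^ m * y)) = P y) :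
    φ (bc q u v).1 = op h5 (n + m) P := by
  simp only [bc, ht, map_sub, map_smul, map_mul, hu, hv, op_mul]
  rw [Nat.add_comm m n]
  exact op_sub_smul h5 (n + m) t _ _ P h

/-- Off-diagonal matrix. -/
def offD {k : Type*} [Field k] (a b : k) : Matrix (Fin 2) (Fin 2) k := !![0, a; b, 0]

/-- Diagonal matrix. -/
def onD {k : Type*} [Field k] (a b : k) : Matrix (Fin 2) (Fin 2) k := !![a, 0; 0, b]

lemma off_off {k : Type*} [Field k] (a b c d : k) : offD a b * offD c d = onD (a * d) (b * c) := by
  simp [offD, onD]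

lemma on_off {k : Type*} [Field k] (a b c d : k) : onD a b * offD c d = offD (a * c) (b * d) := by
  simp [offD, onD]

lemma off_on {k : Type*} [Field k] (a b c d : k) : offD a b * onD c d = offD (a * d) (b * c) := by
  simp [offD, onD]

lemma off_sub {k : Type*} [Field k] (t a b c d : k) :
    offD a b - t • offD c d = offD (a - t * c) (b - t * d) := by
  ext i j
  fin_cases i <;> fin_cases j <;> simp [offD]

lemma on_sub {k : Type*} [Field k] (t a b c d : k) :
    onD a b - t • onD c d = onD (a - t * c) (b - t * d) := by
  ext i j
  fin_cases i <;> fin_cases j <;> simp [onD]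

lemma off_congr {k : Type*} [Field k] {a b c d : k} (h : a = c) (h' : b = d) :
    offD a b = offD c d := by rw [h, h']

lemma on_congr {k : Type*} [Field k] {a b c d : k} (h : a = c) (h' : b = d) :
    onD a b = onD c d := by rw [h, h']

theorem statement_10 {k : Type*} [Field k] [IsAlgClosed k] [CharZero k]
    (ζ : k) (hζ : IsPrimitiveRoot ζ 5)
    (lam₁ lam₂ : k)
    (q : Fin 2 → Fin 2 → k) (hq : q = ![![ζ, 1], ![ζ ^ 2, -1]]) :
    (1 : FreeAlgebra k (Fin 2)) ∉ TwoSidedIdeal.span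
      ({(bc q (ygen k 0) (bc q (ygen k 0) (bc q (ygen k 0) (bc q (ygen k 0) (ygen k 1))))).1,
        (bc q (bc q (bc q (bc q (ygen k 0) (bc q (ygen k 0) (ygen k 1))) (bc q (ygen k 0) (ygen k 1))) (bc q (ygen k 0) (ygen k 1))) (bc q (ygen k 0) (ygen k 1))).1,
        (bc q (bc q (ygen k 0) (bc q (ygen k 0) (bc q (ygen k 0) (ygen k 1)))) (bc q (ygen k 0) (bc q (ygen k 0) (ygen k 1)))).1 - algebraMap k (FreeAlgebra k (Fin 2)) lam₁,
        FreeAlgebra.ι k (1 : Fin 2) ^ 2 - algebraMap k (FreeAlgebra k (Fin 2)) lam₂} : Set (FreeAlgebra k (Fin 2))) := by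
  
  have h5 : ζ ^ 5 = 1 := hζ.pow_eq_one
  have h1 : ζ ≠ 1 := hζ.ne_one (by norm_num)
  have hz : 1 + ζ + ζ^2 + ζ^3 + ζ^4 = 0 := by
    have h0 : (ζ - 1) * (1 + ζ + ζ^2 + ζ^3 + ζ^4) = 0 := by linear_combination h5
    exact (mul_eq_zero.mp h0).resolve_left (sub_ne_zero.mpr h1)
  obtain ⟨σ, hσ⟩ := IsAlgClosed.exists_pow_nat_eq lam₂ (n := 2) (by norm_num)
  obtain ⟨c, hc⟩ := IsAlgClosed.exists_pow_nat_eq (lam₁ * (-(2 + 4*ζ + 6*ζ^2 + 3*ζ^3) / 25))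
    (n := 5) (by norm_num)
  have hcL : c ^ 5 * (-(10+5*ζ^2+10*ζ^3)) = lam₁ := by
    rw [hc]
    field_simp
    linear_combination lam₁ * (- 5 + 45*ζ^1 + 30*ζ^2) * hz
  obtain ⟨φ, hφ⟩ : ∃ φ : FreeAlgebra k (Fin 2) →ₐ[k] Module.End k (Mu5 k → Fin 2 → k),
      ∀ i, φ (FreeAlgebra.ι k i) = ![op h5 1 (fun _ => onD c c),
        op h5 0 (fun y => !![σ, fu ζ y; fv ζ y, -σ])] i :=
    ⟨FreeAlgebra.lift k _, fun i => FreeAlgebra.lift_ι_apply _ i⟩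
  have g1 : φ (ygen k (0 : Fin 2)).1 = op h5 1 (fun _ => onD c c) := by
    simpa [ygen] using hφ 0
  have g2 : φ (ygen k (1 : Fin 2)).1 = op h5 0 (fun y => !![σ, fu ζ y; fv ζ y, -σ]) := by
    simpa [ygen] using hφ 1
  have y12 := bc_rep h5 φ q g1 g2 (1) (by
    simp [qForm, bc, ygen, Fin.prod_univ_two, hq]
    all_goals first
      | ring1
      | (linear_combination (ζ^5 + 1) * h5)
      | (linear_combination (-ζ^5 - 1) * h5)
      | (linear_combination ζ^2 * h5)) (fun y => offD (c * fu1 ζ y) (c * fv1 ζ y)) (by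
    intro y hy
    have e1 := e_u1 ζ y hz hy
    have e2 := e_v1 ζ y hz hy
    rw [pow_one] at e1 e2
    ext i j
    fin_cases i <;> fin_cases j <;> simp [offD, onD, Matrix.mul_apply, Fin.sum_univ_two]
    · ring
    · linear_combination c * e1
    · linear_combination c * e2
    · ring)
  have y112 := bc_rep h5 φ q g1 y12 (ζ) (by
    simp [qForm, bc, ygen, Fin.prod_univ_two, hq]
    all_goals first
      | ring1
      | (linear_combination (ζ^5 + 1) * h5)
      | (linear_combination (-ζ^5 - 1) * h5)
      | (linear_combination ζ^2 * h5)) (fun y => offD (c^2 * fu2 ζ y) (c^2 * fv2 ζ y)) (by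
    intro y hy
    simp only [on_off, off_on, off_sub]
    apply off_congr
    · linear_combination c^2 * e_u2 ζ y hz hy
    · linear_combination c^2 * e_v2 ζ y hz hy)
  have y1112 := bc_rep h5 φ q g1 y112 (ζ^2) (by
    simp [qForm, bc, ygen, Fin.prod_univ_two, hq]
    all_goals first
      | ring1
      | (linear_combination (ζ^5 + 1) * h5)
      | (linear_combination (-ζ^5 - 1) * h5)
      | (linear_combination ζ^2 * h5)) (fun y => offD 0 (c^3 * fv3 ζ y)) (by
    intro y hy
    simp only [on_off, off_on, off_sub]
    apply off_congr
    · linear_combination c^3 * e_u3 ζ y hz hy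
    · linear_combination c^3 * e_v3 ζ y hz hy)
  have y11112 := bc_rep h5 φ q g1 y1112 (ζ^3) (by
    simp [qForm, bc, ygen, Fin.prod_univ_two, hq]
    all_goals first
      | ring1
      | (linear_combination (ζ^5 + 1) * h5)
      | (linear_combination (-ζ^5 - 1) * h5)
      | (linear_combination ζ^2 * h5)) (fun y => offD 0 0) (by
    intro y hy
    simp only [on_off, off_on, off_sub]
    apply off_congr
    · linear_combination 0
    · linear_combination c^4 * e_v4 ζ y hz hy)
  have yL := bc_rep h5 φ q y1112 y112 (-1) (by
    simp [qForm, bc, ygen, Fin.prod_univ_two, hq]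
    all_goals first
      | ring1
      | (linear_combination (ζ^5 + 1) * h5)
      | (linear_combination (-ζ^5 - 1) * h5)
      | (linear_combination ζ^2 * h5)) (fun y => onD (c^5 * (-(10+5*ζ^2+10*ζ^3))) (c^5 * (-(10+5*ζ^2+10*ζ^3)))) (by
    intro y hy
    simp only [off_off, on_sub]
    apply on_congr
    · linear_combination c^5 * e_L1 ζ y hz hy
    · linear_combination c^5 * e_L2 ζ y hz hy)
  have yA := bc_rep h5 φ q y112 y12 (-ζ^4) (by
    simp [qForm, bc, ygen, Fin.prod_univ_two, hq]
    all_goals first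
      | ring1
      | (linear_combination (ζ^5 + 1) * h5)
      | (linear_combination (-ζ^5 - 1) * h5)
      | (linear_combination ζ^2 * h5)) (fun y => onD (c^3 * fa1 ζ y) (c^3 * fa2 ζ y)) (by
    intro y hy
    simp only [off_off, on_sub]
    apply on_congr
    · linear_combination c^3 * e_a1 ζ y hz hy
    · linear_combination c^3 * e_a2 ζ y hz hy)
  have yB := bc_rep h5 φ q yA y12 (ζ^2) (by
    simp [qForm, bc, ygen, Fin.prod_univ_two, hq]
    all_goals first
      | ring1
      | (linear_combination (ζ^5 + 1) * h5)
      | (linear_combination (-ζ^5 - 1) * h5)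
      | (linear_combination ζ^2 * h5)) (fun y => offD (c^4 * fb1 ζ y) (c^4 * fb2 ζ y)) (by
    intro y hy
    simp only [on_off, off_on, off_sub]
    apply off_congr
    · linear_combination c^4 * e_b1 ζ y hz hy
    · linear_combination c^4 * e_b2 ζ y hz hy)
  have yQ := bc_rep h5 φ q yB y12 (-1) (by
    simp [qForm, bc, ygen, Fin.prod_univ_two, hq]
    all_goals first
      | ring1
      | (linear_combination (ζ^5 + 1) * h5)
      | (linear_combination (-ζ^5 - 1) * h5)
      | (linear_combination ζ^2 * h5)) (fun y => onD 0 0) (by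
    intro y hy
    simp only [off_off, on_sub]
    apply on_congr
    · linear_combination c^5 * e_q1 ζ y hz hy
    · linear_combination c^5 * e_q2 ζ y hz hy)
  have off0 : offD (0 : k) 0 = 0 := by
    ext i j
    fin_cases i <;> fin_cases j <;> simp [offD]
  have on0 : onD (0 : k) 0 = 0 := by
    ext i j
    fin_cases i <;> fin_cases j <;> simp [onD]
  have r4 : φ (FreeAlgebra.ι k (1 : Fin 2) ^ 2) = algebraMap k _ lam₂ := by
    have g2' : φ (FreeAlgebra.ι k (1 : Fin 2)) = _ := g2
    rw [map_pow, g2', sq, op_mul]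
    apply op_scalar h5 _ (by simp)
    intro y hy
    have e1 := e_uv ζ y hz hy
    have e2 := e_vu ζ y hz hy
    ext i j
    fin_cases i <;> fin_cases j <;> simp [Matrix.mul_apply, Fin.sum_univ_two]
    · linear_combination hσ + e1
    · ring
    · ring
    · linear_combination hσ + e2
  have r3 := yL.trans (op_scalar h5 _ (by simpa using h5) lam₁ _ (by
    intro y hy
    rw [hcL]
    ext i j
    fin_cases i <;> fin_cases j <;> simp [onD]))
  simp only [off0, op_zero] at y11112
  simp only [on0, op_zero] at yQ
  intro hmem
  have hle := (TwoSidedIdeal.span_le (I := TwoSidedIdeal.ker φ)).mpr (by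
    intro x hx
    simp only [Set.mem_insert_iff, Set.mem_singleton_iff] at hx
    rw [SetLike.mem_coe, TwoSidedIdeal.mem_ker]
    rcases hx with rfl | rfl | rfl | rfl
    · exact y11112
    · exact yQ
    · rw [map_sub, r3, AlgHom.commutes, sub_self]
    · rw [map_sub, r4, AlgHom.commutes, sub_self]) hmem
  rw [TwoSidedIdeal.mem_ker, map_one] at hle
  have hne : Nonempty (Mu5 k) := ⟨⟨1, one_pow 5⟩⟩
  exact one_ne_zero hle
end

section
/- Let k be an algebraically closed field of characteristic 0, ζ ∈ k a primitive 3rd root of unity, and b ∈ k a nonzero scalar. Let the 3×3 braiding matrix be q_{11} = ζ, q_{12} = bζ², q_{13} = b⁻³ζ², q_{21} = b⁻¹, q_{22} = ζ, q_{23} = b, q_{31} = b³ζ, q_{32} = b⁻¹ζ, q_{33} = ζ² (Cartan type C₃ with N = 3). Then for every λ ∈ k, the quotient of the free algebra k⟨y_1,y_2,y_3⟩ by the two-sided ideal generated by y_{112}, y_{332}, y_{13}, and [[y_{(13)}, y_2]_c, y_2]_c − λ is a nontrivial algebra. -/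
/-- Images of the three generators in a six-dimensional representation. -/
def repY {k : Type*} [Field k] (ζ b lam : k) : Fin 3 → Matrix (Fin 6) (Fin 6) k :=
  ![!![0,0,0,0,0,0; 0,0,0,0,0,0; 0,0,0,0,0,0; 0,0,1,0,0,0; 0,0,0,0,0,0; 0,0,0,0,0,0],
    !![0,0,0,0,1,0; 0,0,0,0,0,b*ζ^2; 0,1,0,0,0,0; 0,0,0,0,0,0; 0,0,0,1,0,0; 0,0,0,0,0,0],
    !![0,0,0,0,0,0; lam,0,0,0,0,0; 0,0,0,0,0,0; 0,0,0,0,0,0; 0,0,0,0,0,0; 0,0,0,0,lam,0]]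

theorem statement_11 {k : Type*} [Field k] [IsAlgClosed k] [CharZero k]
    (ζ : k) (hζ : IsPrimitiveRoot ζ 3) (b : k) (hb : b ≠ 0)
    (lam : k)
    (q : Fin 3 → Fin 3 → k) (hq : q = ![![ζ, b * ζ ^ 2, (b ^ 3)⁻¹ * ζ ^ 2], ![b⁻¹, ζ, b], ![b ^ 3 * ζ, b⁻¹ * ζ, ζ ^ 2]]) :
    (1 : FreeAlgebra k (Fin 3)) ∉ TwoSidedIdeal.span
      ({(bc q (ygen k 0) (bc q (ygen k 0) (ygen k 1))).1,
        (bc q (ygen k 2) (bc q (ygen k 2) (ygen k 1))).1,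
        (bc q (ygen k 0) (ygen k 2)).1,
        (bc q (bc q (bc q (ygen k 0) (bc q (ygen k 1) (ygen k 2))) (ygen k 1)) (ygen k 1)).1 - algebraMap k (FreeAlgebra k (Fin 3)) lam} : Set (FreeAlgebra k (Fin 3))) := by
  have h3 : ζ ^ 3 = 1 := hζ.pow_eq_one
  have h2 : ζ ^ 2 + ζ + 1 = 0 := by
    have h := sub_ne_zero.mpr (hζ.ne_one (by norm_num))
    apply mul_left_cancel₀ h
    linear_combination h3
  have hz0 : ζ ≠ 0 := hζ.ne_zero (by norm_num)
  let f : FreeAlgebra k (Fin 3) →ₐ[k] Matrix (Fin 6) (Fin 6) k :=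
    FreeAlgebra.lift k (repY ζ b lam)
  have hf : ∀ i, f (FreeAlgebra.ι k i) = repY ζ b lam i := fun i => by
    simp [f]
  intro h1
  have hle : TwoSidedIdeal.span
      ({(bc q (ygen k 0) (bc q (ygen k 0) (ygen k 1))).1,
        (bc q (ygen k 2) (bc q (ygen k 2) (ygen k 1))).1,
        (bc q (ygen k 0) (ygen k 2)).1,
        (bc q (bc q (bc q (ygen k 0) (bc q (ygen k 1) (ygen k 2))) (ygen k 1)) (ygen k 1)).1 - algebraMap k (FreeAlgebra k (Fin 3)) lam} : Set (FreeAlgebra k (Fin 3)))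
      ≤ TwoSidedIdeal.ker f := by
    rw [TwoSidedIdeal.span_le]
    intro x hx
    simp only [Set.mem_insert_iff, Set.mem_singleton_iff] at hx
    rw [SetLike.mem_coe, TwoSidedIdeal.mem_ker]
    subst hq
    clear h1
    rcases hx with rfl | rfl | rfl | rfl
    · simp [bc, ygen, hf, qForm, Fin.prod_univ_three, repY]
      ext i j; fin_cases i <;> fin_cases j <;> simp
    · simp [bc, ygen, hf, qForm, Fin.prod_univ_three, repY]
      ext i j; fin_cases i <;> fin_cases j <;> simp
    · simp [bc, ygen, hf, qForm, Fin.prod_univ_three, repY]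
      ext i j; fin_cases i <;> fin_cases j <;> simp
    · have e : algebraMap k (Matrix (Fin 6) (Fin 6) k) lam =
        !![lam,0,0,0,0,0; 0,lam,0,0,0,0; 0,0,lam,0,0,0; 0,0,0,lam,0,0; 0,0,0,0,lam,0; 0,0,0,0,0,lam] := by
        ext i j; fin_cases i <;> fin_cases j <;> simp [Matrix.algebraMap_matrix_apply]
      simp [bc, ygen, hf, qForm, Fin.prod_univ_three, repY, e]
      ext i j; fin_cases i <;> fin_cases j <;> simp <;> field_simp <;> grind
  have := hle h1
  rw [TwoSidedIdeal.mem_ker, map_one] at this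
  exact one_ne_zero this
end
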